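/- Existence: Suppose a Hamiltonian H : [0,T] × C × ℝⁿ → ℝ satisfies conditions (A.1)–(A.5) and σ : C → ℝ satisfies (A.6). Then there exists at least one minimax solution of the Cauchy problem ∂ₜφ + H(t,x(·),∇φ) = 0 on [0,T) × C with boundary condition φ(T,x(·)) = σ(x(·)). -/

import Mathlib

open MeasureTheory Set Filter Topology

noncomputable section

attribute [local instance] Classical.propDecidable

/-- Euclidean space `ℝⁿ`. -/
abbrev Euc (n : ℕ) : Type := EuclideanSpace ℝ (Fin n)

/-- The path space `C([-h,T], ℝⁿ)` with the sup norm. -/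
abbrev PathSp (n : ℕ) (h T : ℝ) : Type := ContinuousMap (Set.Icc (-h) T) (Euc n)

/-- The time map `τ ↦ τ ∧ t` on `[-h,T]` (for `t ∈ [0,T]`, `h ≥ 0`, this is `min τ t`). -/
def stopTime (h T t : ℝ) (τ : Set.Icc (-h) T) : Set.Icc (-h) T :=
  ⟨max (-h) (min τ.1 t), le_max_left _ _,
    max_le (le_trans τ.2.1 τ.2.2) (le_trans (min_le_left _ _) τ.2.2)⟩

lemma continuous_stopTime (h T t : ℝ) : Continuous (stopTime h T t) :=
  Continuous.subtype_mk
    (continuous_const.max (continuous_subtype_val.min continuous_const)) _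

/-- The stopped path `x(· ∧ t)`. -/
def stopPath {n : ℕ} {h T : ℝ} (t : ℝ) (x : PathSp n h T) : PathSp n h T :=
  x.comp ⟨stopTime h T t, continuous_stopTime h T t⟩

/-- Evaluation of a path at a real time (times outside `[-h,T]` are projected). -/
def evalP {n : ℕ} {h T : ℝ} (x : PathSp n h T) (τ : ℝ) : Euc n :=
  if hc : -h ≤ T then x (Set.projIcc (-h) T hc τ) else 0

/-- The `L¹([0,T])` distance between two functions. -/
def L1dist (T : ℝ) (c₁ c₂ : ℝ → ℝ) : ℝ := ∫ τ in Set.Icc (0:ℝ) T, |c₁ τ - c₂ τ|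

/-- A nonnegative function in `L¹([0,T],ℝ)`. -/
def IntegNonneg (T : ℝ) (c : ℝ → ℝ) : Prop :=
  IntegrableOn c (Set.Icc 0 T) volume ∧ ∀ τ ∈ Set.Icc (0:ℝ) T, 0 ≤ c τ

/-- `AC(t,x(·))`, presented with an explicit derivative witness: pairs `(y, y')`
such that `y(·∧t) = x(·∧t)`, `y'` is integrable on `[t,T]`, and `y` is the
indefinite integral of `y'` on `[t,T]` (i.e. `y|_{[t,T]}` is absolutely continuous
with a.e. derivative `y'`). -/
def ACPair {n : ℕ} {h T : ℝ} (t : ℝ) (x : PathSp n h T) :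
    Set (PathSp n h T × (ℝ → Euc n)) :=
  {p | stopPath t p.1 = stopPath t x ∧ IntervalIntegrable p.2 volume t T ∧
       ∀ τ ∈ Set.Icc t T, evalP p.1 τ = evalP p.1 t + ∫ ξ in t..τ, p.2 ξ}

/-- The set `AC(t,x(·))`. -/
def ACSet {n : ℕ} {h T : ℝ} (t : ℝ) (x : PathSp n h T) : Set (PathSp n h T) :=
  {y | ∃ y', (y, y') ∈ ACPair t x}

/-- Pairs `(y, y')` with `y ∈ Y(t,x(·);c(·))` and derivative witness `y'`. -/
def YPair {n : ℕ} {h T : ℝ} (t : ℝ) (x : PathSp n h T) (c : ℝ → ℝ) :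
    Set (PathSp n h T × (ℝ → Euc n)) :=
  {p | p ∈ ACPair t x ∧
       ∀ᵐ τ ∂(volume.restrict (Set.Icc t T)), ‖p.2 τ‖ ≤ c τ * (1 + ‖stopPath τ p.1‖)}

/-- The set `Y(t,x(·);c(·))`. -/
def YSet {n : ℕ} {h T : ℝ} (t : ℝ) (x : PathSp n h T) (c : ℝ → ℝ) :
    Set (PathSp n h T) :=
  {y | ∃ y', (y, y') ∈ YPair t x c}

/-- Condition (A.1): measurability in `t` on `[0,T]`. -/
def CondA1 {n : ℕ} {h T : ℝ} (H : ℝ → PathSp n h T → Euc n → ℝ) : Prop :=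
  ∀ (x : PathSp n h T) (s : Euc n),
    Measurable ((Set.Icc (0:ℝ) T).restrict (fun t => H t x s))

/-- Condition (A.2): continuity in `(x,s)` for a.e. `t`. -/
def CondA2 {n : ℕ} {h T : ℝ} (H : ℝ → PathSp n h T → Euc n → ℝ) : Prop :=
  ∃ E : Set ℝ, E ⊆ Set.Icc 0 T ∧ volume E = ENNReal.ofReal T ∧
    ∀ t ∈ E, Continuous (fun p : PathSp n h T × Euc n => H t p.1 p.2)

/-- Condition (A.3) for a given compact set `D` and function `λ_H(·;D)`. -/
def CondA3For {n : ℕ} {h T : ℝ} (H : ℝ → PathSp n h T → Euc n → ℝ)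
    (D : Set (PathSp n h T)) (lam : ℝ → ℝ) : Prop :=
  IntegNonneg T lam ∧
  ∀ x₁ ∈ D, ∀ x₂ ∈ D, ∀ s : Euc n,
    ∃ E : Set ℝ, E ⊆ Set.Icc 0 T ∧ volume E = ENNReal.ofReal T ∧
      ∀ t ∈ E, |H t x₁ s - H t x₂ s| ≤
        lam t * (1 + ‖s‖) * ‖stopPath t x₁ - stopPath t x₂‖

/-- Condition (A.3). -/
def CondA3 {n : ℕ} {h T : ℝ} (H : ℝ → PathSp n h T → Euc n → ℝ) : Prop :=
  ∀ D : Set (PathSp n h T), IsCompact D → ∃ lam : ℝ → ℝ, CondA3For H D lam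

/-- Condition (A.4), with the function `c_H(·)` made explicit. -/
def CondA4 {n : ℕ} {h T : ℝ} (H : ℝ → PathSp n h T → Euc n → ℝ) (cH : ℝ → ℝ) : Prop :=
  IntegNonneg T cH ∧
  ∃ E : Set ℝ, E ⊆ Set.Icc 0 T ∧ volume E = ENNReal.ofReal T ∧
    ∀ t ∈ E, ∀ (x : PathSp n h T) (s₁ s₂ : Euc n),
      |H t x s₁ - H t x s₂| ≤ cH t * (1 + ‖stopPath t x‖) * ‖s₁ - s₂‖

/-- Condition (A.5) for a given compact set `D` and function `m_H(·;D)`. -/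
def CondA5For {n : ℕ} {h T : ℝ} (H : ℝ → PathSp n h T → Euc n → ℝ)
    (D : Set (PathSp n h T)) (m : ℝ → ℝ) : Prop :=
  IntegNonneg T m ∧
  ∀ x ∈ D, ∃ E : Set ℝ, E ⊆ Set.Icc 0 T ∧ volume E = ENNReal.ofReal T ∧
    ∀ t ∈ E, |H t x (0 : Euc n)| ≤ m t

/-- Condition (A.5). -/
def CondA5 {n : ℕ} {h T : ℝ} (H : ℝ → PathSp n h T → Euc n → ℝ) : Prop :=
  ∀ D : Set (PathSp n h T), IsCompact D → ∃ m : ℝ → ℝ, CondA5For H D m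

/-- Conditions (A.1)–(A.5), with the function `c_H(·)` from (A.4) made explicit. -/
def CondA {n : ℕ} {h T : ℝ} (H : ℝ → PathSp n h T → Euc n → ℝ) (cH : ℝ → ℝ) : Prop :=
  CondA1 H ∧ CondA2 H ∧ CondA3 H ∧ CondA4 H cH ∧ CondA5 H

/-- A functional `φ` on `[0,T] × C` is non-anticipative. -/
def NonAnticipative {n : ℕ} {h T : ℝ} (φ : ℝ → PathSp n h T → ℝ) : Prop :=
  ∀ t ∈ Set.Icc (0:ℝ) T, ∀ x : PathSp n h T, φ t x = φ t (stopPath t x)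

/-- Property (U) from the definition of an upper solution. -/
def PropU {n : ℕ} {h T : ℝ} (H : ℝ → PathSp n h T → Euc n → ℝ) (cH : ℝ → ℝ)
    (φ : ℝ → PathSp n h T → ℝ) : Prop :=
  ∀ t ∈ Set.Ico (0:ℝ) T, ∀ x : PathSp n h T, ∀ s : Euc n, ∀ τ ∈ Set.Ioc t T,
    ∃ p ∈ YPair t x cH,
      φ τ p.1 - ∫ ξ in t..τ, (@inner ℝ _ _ s (p.2 ξ) - H ξ p.1 s) ≤ φ t x

/-- Property (L) from the definition of a lower solution. -/
def PropL {n : ℕ} {h T : ℝ} (H : ℝ → PathSp n h T → Euc n → ℝ) (cH : ℝ → ℝ)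
    (φ : ℝ → PathSp n h T → ℝ) : Prop :=
  ∀ t ∈ Set.Ico (0:ℝ) T, ∀ x : PathSp n h T, ∀ s : Euc n, ∀ τ ∈ Set.Ioc t T,
    ∃ p ∈ YPair t x cH,
      φ t x ≤ φ τ p.1 - ∫ ξ in t..τ, (@inner ℝ _ _ s (p.2 ξ) - H ξ p.1 s)

/-- Upper solution of the Cauchy problem for `H` (with `c_H` from (A.4)) and `σ`. -/
def UpperSol {n : ℕ} {h T : ℝ} (H : ℝ → PathSp n h T → Euc n → ℝ) (cH : ℝ → ℝ)
    (σ : PathSp n h T → ℝ) (φ : ℝ → PathSp n h T → ℝ) : Prop :=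
  NonAnticipative φ ∧
  LowerSemicontinuousOn (fun p : ℝ × PathSp n h T => φ p.1 p.2)
    (Set.Icc 0 T ×ˢ (Set.univ : Set (PathSp n h T))) ∧
  (∀ x : PathSp n h T, σ x ≤ φ T x) ∧
  PropU H cH φ

/-- Lower solution of the Cauchy problem for `H` (with `c_H` from (A.4)) and `σ`. -/
def LowerSol {n : ℕ} {h T : ℝ} (H : ℝ → PathSp n h T → Euc n → ℝ) (cH : ℝ → ℝ)
    (σ : PathSp n h T → ℝ) (φ : ℝ → PathSp n h T → ℝ) : Prop :=
  NonAnticipative φ ∧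
  UpperSemicontinuousOn (fun p : ℝ × PathSp n h T => φ p.1 p.2)
    (Set.Icc 0 T ×ˢ (Set.univ : Set (PathSp n h T))) ∧
  (∀ x : PathSp n h T, φ T x ≤ σ x) ∧
  PropL H cH φ

/-- Minimax solution of the Cauchy problem. -/
def MinimaxSol {n : ℕ} {h T : ℝ} (H : ℝ → PathSp n h T → Euc n → ℝ) (cH : ℝ → ℝ)
    (σ : PathSp n h T → ℝ) (φ : ℝ → PathSp n h T → ℝ) : Prop :=
  UpperSol H cH σ φ ∧ LowerSol H cH σ φ

/-- `φ` is ci-differentiable at `(t,x(·))` with ci-derivatives `a = ∂ₜφ(t,x(·))`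
and `g = ∇φ(t,x(·))`. -/
def HasCiDeriv {n : ℕ} {h T : ℝ} (φ : ℝ → PathSp n h T → ℝ)
    (t : ℝ) (x : PathSp n h T) (a : ℝ) (g : Euc n) : Prop :=
  ∀ p ∈ ACPair t x, ∃ o : ℝ → ℝ,
    (∀ τ ∈ Set.Ioc t T,
      φ τ p.1 - φ t x =
        a * (τ - t) + @inner ℝ _ _ g (evalP p.1 τ - evalP x t) + o (τ - t)) ∧
    Tendsto (fun τ => o (τ - t) / (τ - t + ∫ ξ in t..τ, ‖p.2 ξ‖))
      (nhdsWithin t (Set.Ioi t)) (nhds 0)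

/-- `φ ∈ Φ`, with the ci-derivatives `Dt = ∂ₜφ`, `Dx = ∇φ` and the full-measure
set `Eφ` of ci-differentiability made explicit. -/
structure IsInPhi {n : ℕ} {h T : ℝ} (φ : ℝ → PathSp n h T → ℝ)
    (Dt : ℝ → PathSp n h T → ℝ) (Dx : ℝ → PathSp n h T → Euc n)
    (Eφ : Set ℝ) : Prop where
  cont : ContinuousOn (fun p : ℝ × PathSp n h T => φ p.1 p.2)
    (Set.Icc 0 T ×ˢ (Set.univ : Set (PathSp n h T)))
  absCont : ∀ t ∈ Set.Ico (0:ℝ) T, ∀ x : PathSp n h T, ∀ p ∈ ACPair t x,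
    ∀ θ ∈ Set.Ioo t T, ∃ g : ℝ → ℝ, IntervalIntegrable g volume t θ ∧
      ∀ τ ∈ Set.Icc t θ, φ τ p.1 = φ t p.1 + ∫ ξ in t..τ, g ξ
  Esub : Eφ ⊆ Set.Ico 0 T
  Efull : volume Eφ = ENNReal.ofReal T
  ciDiff : ∀ t ∈ Eφ, ∀ x : PathSp n h T, HasCiDeriv φ t x (Dt t x) (Dx t x)
  measD : ∀ x : PathSp n h T, Measurable (Eφ.restrict (fun t => (Dt t x, Dx t x)))
  contD : ∀ t ∈ Eφ, Continuous (fun x : PathSp n h T => (Dt t x, Dx t x))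
  bddD : ∀ D : Set (PathSp n h T), IsCompact D → ∀ θ ∈ Set.Ico (0:ℝ) T,
    ∃ m : ℝ → ℝ, (IntegrableOn m (Set.Icc 0 θ) volume ∧ ∀ τ ∈ Set.Icc (0:ℝ) θ, 0 ≤ m τ) ∧
      ∃ ℓ : ℝ, 0 < ℓ ∧ ∀ t ∈ Eφ ∩ Set.Icc 0 θ, ∀ x ∈ D, |Dt t x| ≤ m t ∧ ‖Dx t x‖ ≤ ℓ

/-- Semiclassical solution of the Cauchy problem (with derivative data). -/
def SemiclassicalSol {n : ℕ} {h T : ℝ} (H : ℝ → PathSp n h T → Euc n → ℝ)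
    (σ : PathSp n h T → ℝ) (φ : ℝ → PathSp n h T → ℝ)
    (Dt : ℝ → PathSp n h T → ℝ) (Dx : ℝ → PathSp n h T → Euc n) (Eφ : Set ℝ) : Prop :=
  IsInPhi φ Dt Dx Eφ ∧
  (∀ t ∈ Eφ, ∀ x : PathSp n h T, Dt t x + H t x (Dx t x) = 0) ∧
  ∀ x : PathSp n h T, φ T x = σ x

/-- The Steklov transform of `H` with respect to the first (time) variable,
with `H` extended by `0` outside `[0,T]`. -/
def steklov {n : ℕ} {h T : ℝ} (H : ℝ → PathSp n h T → Euc n → ℝ) (k : ℕ)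
    (t : ℝ) (x : PathSp n h T) (s : Euc n) : ℝ :=
  ((k : ℝ) / 2) * ∫ τ in (t - (k : ℝ)⁻¹)..(t + (k : ℝ)⁻¹),
    (if τ ∈ Set.Icc (0:ℝ) T then H τ (stopPath t x) s else 0)

/-! ### Differential game definitions -/

/-- Admissible controls with values in `P`. -/
def Ctrl {m : ℕ} (P : Set (Euc m)) : Set (ℝ → Euc m) :=
  {u | Measurable u ∧ ∀ τ, u τ ∈ P}

/-- Non-anticipative strategies mapping `Q`-valued controls to `P`-valued controls
on the interval `[t,T]`. -/
def NAStrat {mP mQ : ℕ} (P : Set (Euc mP)) (Q : Set (Euc mQ)) (t T : ℝ) :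
    Set ((ℝ → Euc mQ) → ℝ → Euc mP) :=
  {α | (∀ v ∈ Ctrl Q, α v ∈ Ctrl P) ∧
    ∀ τ ∈ Set.Icc t T, ∀ v ∈ Ctrl Q, ∀ v' ∈ Ctrl Q,
      (∀ᵐ ξ ∂(volume.restrict (Set.Icc t τ)), v ξ = v' ξ) →
      (∀ᵐ ξ ∂(volume.restrict (Set.Icc t τ)), α v ξ = α v' ξ)}

/-- `(y, y')` is (the derivative-witnessed) motion of the time-delay system
generated by `f` from `(t,x(·))` under controls `u(·)`, `v(·)`. -/
def IsMotion {n : ℕ} {h T : ℝ} {mP mQ : ℕ}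
    (f : ℝ → PathSp n h T → Euc mP → Euc mQ → Euc n)
    (t : ℝ) (x : PathSp n h T) (u : ℝ → Euc mP) (v : ℝ → Euc mQ)
    (p : PathSp n h T × (ℝ → Euc n)) : Prop :=
  p ∈ ACPair t x ∧
  ∀ᵐ τ ∂(volume.restrict (Set.Icc t T)), p.2 τ = f τ p.1 (u τ) (v τ)

/-- The set of values of the cost functional along motions (a singleton when
the motion exists and is unique). -/
def costVals {n : ℕ} {h T : ℝ} {mP mQ : ℕ}
    (f : ℝ → PathSp n h T → Euc mP → Euc mQ → Euc n)
    (χ : ℝ → PathSp n h T → Euc mP → Euc mQ → ℝ) (σ : PathSp n h T → ℝ)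
    (t : ℝ) (x : PathSp n h T) (u : ℝ → Euc mP) (v : ℝ → Euc mQ) : Set ℝ :=
  {r | ∃ p : PathSp n h T × (ℝ → Euc n), IsMotion f t x u v p ∧
        r = σ p.1 - ∫ τ in t..T, χ τ p.1 (u τ) (v τ)}

/-- The lower value `ρ⁻(t,x(·))` of the differential game. -/
def lowerValue {n : ℕ} {h T : ℝ} {mP mQ : ℕ} (P : Set (Euc mP)) (Q : Set (Euc mQ))
    (f : ℝ → PathSp n h T → Euc mP → Euc mQ → Euc n)
    (χ : ℝ → PathSp n h T → Euc mP → Euc mQ → ℝ) (σ : PathSp n h T → ℝ)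
    (t : ℝ) (x : PathSp n h T) : ℝ :=
  sInf ((fun α => sSup (⋃ v ∈ Ctrl Q, costVals f χ σ t x (α v) v)) '' NAStrat P Q t T)

/-- The upper value `ρ⁺(t,x(·))` of the differential game. -/
def upperValue {n : ℕ} {h T : ℝ} {mP mQ : ℕ} (P : Set (Euc mP)) (Q : Set (Euc mQ))
    (f : ℝ → PathSp n h T → Euc mP → Euc mQ → Euc n)
    (χ : ℝ → PathSp n h T → Euc mP → Euc mQ → ℝ) (σ : PathSp n h T → ℝ)
    (t : ℝ) (x : PathSp n h T) : ℝ :=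
  sSup ((fun β => sInf (⋃ u ∈ Ctrl P, costVals f χ σ t x u (β u))) '' NAStrat Q P t T)

/-- The lower Hamiltonian `H⁻` (defined via the full-measure set `EC` from (C.2)). -/
def Hlow {n : ℕ} {h T : ℝ} {mP mQ : ℕ} (P : Set (Euc mP)) (Q : Set (Euc mQ))
    (f : ℝ → PathSp n h T → Euc mP → Euc mQ → Euc n)
    (χ : ℝ → PathSp n h T → Euc mP → Euc mQ → ℝ) (EC : Set ℝ)
    (τ : ℝ) (y : PathSp n h T) (s : Euc n) : ℝ :=
  if τ ∈ EC then
    sSup ((fun v => sInf ((fun u => @inner ℝ _ _ s (f τ y u v) - χ τ y u v) '' P)) '' Q)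
  else 0

/-- The upper Hamiltonian `H⁺` (defined via the full-measure set `EC` from (C.2)). -/
def Hup {n : ℕ} {h T : ℝ} {mP mQ : ℕ} (P : Set (Euc mP)) (Q : Set (Euc mQ))
    (f : ℝ → PathSp n h T → Euc mP → Euc mQ → Euc n)
    (χ : ℝ → PathSp n h T → Euc mP → Euc mQ → ℝ) (EC : Set ℝ)
    (τ : ℝ) (y : PathSp n h T) (s : Euc n) : ℝ :=
  if τ ∈ EC then
    sInf ((fun u => sSup ((fun v => @inner ℝ _ _ s (f τ y u v) - χ τ y u v) '' Q)) '' P)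
  else 0

/-- Assumption (C) on the data `(f, χ, σ)` of the differential game, with the
full-measure set `EC` from (C.2) and the function `c_f(·)` from (C.4) explicit. -/
structure AssumpC {n : ℕ} {h T : ℝ} {mP mQ : ℕ} (P : Set (Euc mP)) (Q : Set (Euc mQ))
    (f : ℝ → PathSp n h T → Euc mP → Euc mQ → Euc n)
    (χ : ℝ → PathSp n h T → Euc mP → Euc mQ → ℝ)
    (σ : PathSp n h T → ℝ) (EC : Set ℝ) (cf : ℝ → ℝ) : Prop where
  meas : ∀ (y : PathSp n h T) (u : Euc mP) (v : Euc mQ),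
    Measurable ((Set.Icc (0:ℝ) T).restrict (fun τ => (f τ y u v, χ τ y u v)))
  ECsub : EC ⊆ Set.Icc 0 T
  ECfull : volume EC = ENNReal.ofReal T
  contOn : ∀ τ ∈ EC, ContinuousOn
    (fun p : PathSp n h T × Euc mP × Euc mQ => (f τ p.1 p.2.1 p.2.2, χ τ p.1 p.2.1 p.2.2))
    ((Set.univ : Set (PathSp n h T)) ×ˢ P ×ˢ Q)
  lip : ∀ D : Set (PathSp n h T), IsCompact D → ∃ lam : ℝ → ℝ, IntegNonneg T lam ∧
    ∃ E : Set ℝ, E ⊆ Set.Icc 0 T ∧ volume E = ENNReal.ofReal T ∧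
      ∀ τ ∈ E, ∀ y₁ ∈ D, ∀ y₂ ∈ D, ∀ u ∈ P, ∀ v ∈ Q,
        ‖f τ y₁ u v - f τ y₂ u v‖ + |χ τ y₁ u v - χ τ y₂ u v| ≤
          lam τ * ‖stopPath τ y₁ - stopPath τ y₂‖
  growth : IntegNonneg T cf ∧
    ∃ E : Set ℝ, E ⊆ Set.Icc 0 T ∧ volume E = ENNReal.ofReal T ∧
      ∀ τ ∈ E, ∀ y : PathSp n h T, ∀ u ∈ P, ∀ v ∈ Q,
        ‖f τ y u v‖ ≤ cf τ * (1 + ‖stopPath τ y‖)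
  bdd : ∀ D : Set (PathSp n h T), IsCompact D → ∃ m : ℝ → ℝ, IntegNonneg T m ∧
    ∃ E : Set ℝ, E ⊆ Set.Icc 0 T ∧ volume E = ENNReal.ofReal T ∧
      ∀ τ ∈ E, ∀ y ∈ D, ∀ u ∈ P, ∀ v ∈ Q, |χ τ y u v| ≤ m τ
  sigC : Continuous σ


set_option linter.unusedSectionVars false
set_option linter.unusedVariables false

lemma ac_of_dom {X Y : Type*} [PseudoMetricSpace X] [PseudoMetricSpace Y] {f : ℝ → X} {G : ℝ → Y} {a b : ℝ}
    (hG : AbsolutelyContinuousOnInterval G a b)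
    (hd : ∀ x ∈ uIcc a b, ∀ y ∈ uIcc a b, dist (f x) (f y) ≤ dist (G x) (G y)) :
    AbsolutelyContinuousOnInterval f a b := by
  rw [absolutelyContinuousOnInterval_iff] at hG ⊢
  intro ε hε
  obtain ⟨δ, hδ, h⟩ := hG ε hε
  refine ⟨δ, hδ, fun E hE hs => lt_of_le_of_lt ?_ (h E hE hs)⟩
  refine Finset.sum_le_sum fun i hi => ?_
  have := hE.1 i hi
  exact hd _ this.1 _ this.2

lemma ac_of_bound {n : ℕ} {f : ℝ → Euc n} {g : ℝ → ℝ} {t T : ℝ} (htT : t ≤ T)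
    (hg : IntervalIntegrable g volume t T)
    (hb : ∀ a b, t ≤ a → a ≤ b → b ≤ T → ‖f b - f a‖ ≤ ∫ ξ in a..b, g ξ) :
    AbsolutelyContinuousOnInterval f t T := by
  have hG := hg.absolutelyContinuousOnInterval_intervalIntegral (c := t) (by simp)
  refine ac_of_dom hG ?_
  have key : ∀ x ∈ Icc t T, ∀ y ∈ Icc t T, x ≤ y →
      dist (f x) (f y) ≤ dist (∫ ξ in t..x, g ξ) (∫ ξ in t..y, g ξ) := by
    intro x hx y hy hxy
    have h1 : (∫ ξ in t..y, g ξ) - (∫ ξ in t..x, g ξ) = ∫ ξ in x..y, g ξ := by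
      refine intervalIntegral.integral_interval_sub_left ?_ ?_
      · exact hg.mono_set (by rw [uIcc_of_le hy.1, uIcc_of_le htT]; exact Icc_subset_Icc_right hy.2)
      · exact hg.mono_set (by rw [uIcc_of_le hx.1, uIcc_of_le htT]; exact Icc_subset_Icc_right hx.2)
    rw [dist_comm, dist_eq_norm, dist_comm, dist_eq_norm, h1]
    exact (hb x y hx.1 hxy hy.2).trans (le_abs_self _)
  rw [uIcc_of_le htT]
  intro x hx y hy
  rcases le_total x y with h | h
  · exact key x hx y hy h
  · rw [dist_comm, dist_comm (∫ ξ in t..x, g ξ)]; exact key y hy x hx h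

lemma exists_vel {n : ℕ} {f : ℝ → Euc n} {g : ℝ → ℝ} {t T : ℝ} (htT : t ≤ T)
    (hg : IntervalIntegrable g volume t T)
    (hb : ∀ a b, t ≤ a → a ≤ b → b ≤ T → ‖f b - f a‖ ≤ ∫ ξ in a..b, g ξ) :
    ∃ v : ℝ → Euc n, IntervalIntegrable v volume t T ∧
      (∀ τ ∈ Icc t T, f τ = f t + ∫ ξ in t..τ, v ξ) ∧
      ∀ᵐ τ ∂(volume.restrict (Icc t T)), ‖v τ‖ ≤ g τ := by
  have hac := ac_of_bound htT hg hb
  have hcomp : ∀ i : Fin n, AbsolutelyContinuousOnInterval (fun x => f x i) t T := by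
    intro i
    refine ac_of_dom hac fun x _ y _ => ?_
    rw [dist_eq_norm, dist_eq_norm]
    exact PiLp.norm_apply_le (f x - f y) i
  have hdiff : ∀ᵐ x, x ∈ uIcc t T → DifferentiableAt ℝ f x := by
    have : ∀ᵐ x, ∀ i : Fin n, x ∈ uIcc t T → DifferentiableAt ℝ (fun x => f x i) x :=
      ae_all_iff.2 fun i => (hcomp i).ae_differentiableAt
    filter_upwards [this] with x hx hxm
    exact differentiableAt_euclidean.2 fun i => hx i hxm
  have hbound : ∀ᵐ x, x ∈ Icc t T → ‖deriv f x‖ ≤ g x := by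
    have h1 : ∀ᵐ x : ℝ, x ≠ T := by simp [ae_iff, measure_singleton]
    filter_upwards [hdiff, hg.ae_hasDerivAt_integral, h1] with x hx1 hx2 hxT hx
    rw [uIcc_of_le htT] at hx1 hx2
    have hd := (hx1 hx).hasDerivAt
    have hi := hx2 hx t (by simp [htT])
    have e1 : Tendsto (fun y => ‖slope f x y‖) (𝓝[>] x) (𝓝 ‖deriv f x‖) :=
      ((hasDerivAt_iff_tendsto_slope.1 hd).mono_left
        (nhdsWithin_mono _ (fun y hy => ne_of_gt hy))).norm
    have e2 := (hasDerivAt_iff_tendsto_slope.1 hi).mono_left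
        (nhdsWithin_mono x (fun y (hy : y ∈ Ioi x) => (ne_of_gt hy : y ≠ x)))
    refine le_of_tendsto_of_tendsto e1 e2 ?_
    have : Ioo x T ∈ 𝓝[>] x := Ioo_mem_nhdsGT (lt_of_le_of_ne hx.2 hxT)
    filter_upwards [this] with y hy
    have hyx : 0 < y - x := by linarith [hy.1]
    rw [slope_def_field, slope_def_module, norm_smul, norm_inv, Real.norm_of_nonneg hyx.le,
      intervalIntegral.integral_interval_sub_left, div_eq_inv_mul]
    · exact mul_le_mul_of_nonneg_left (hb x y hx.1 hy.1.le hy.2.le) (by positivity)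
    · exact hg.mono_set (by rw [uIcc_of_le (hx.1.trans hy.1.le), uIcc_of_le htT]; exact Icc_subset_Icc_right hy.2.le)
    · exact hg.mono_set (by rw [uIcc_of_le hx.1, uIcc_of_le htT]; exact Icc_subset_Icc_right hx.2)
  have hbr : ∀ᵐ τ ∂(volume.restrict (Icc t T)), ‖deriv f τ‖ ≤ g τ :=
    (ae_restrict_iff' measurableSet_Icc).2 hbound
  have hintg : IntervalIntegrable (deriv f) volume t T := by
    rw [intervalIntegrable_iff_integrableOn_Icc_of_le htT] at hg ⊢
    refine Integrable.mono hg (stronglyMeasurable_deriv f).aestronglyMeasurable ?_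
    filter_upwards [hbr] with x hx using hx.trans (le_abs_self _)
  refine ⟨deriv f, hintg, ?_, hbr⟩
  have hac2 : AbsolutelyContinuousOnInterval (fun x => ∫ ξ in t..x, deriv f ξ) t T := by
    refine ac_of_bound htT hintg.norm fun a b ha hab hbT => ?_
    rw [intervalIntegral.integral_interval_sub_left]
    · exact intervalIntegral.norm_integral_le_integral_norm hab
    · exact hintg.mono_set (by rw [uIcc_of_le (ha.trans hab), uIcc_of_le htT]; exact Icc_subset_Icc_right hbT)
    · exact hintg.mono_set (by rw [uIcc_of_le ha, uIcc_of_le htT]; exact Icc_subset_Icc_right (hab.trans hbT))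
  obtain ⟨C, hC⟩ := (hac.sub hac2).const_of_ae_hasDerivAt_zero (by
    filter_upwards [hdiff, hintg.ae_hasDerivAt_integral] with x hx₁ hx₂ hx₃
    have := (hx₁ hx₃).hasDerivAt.sub (hx₂ hx₃ t (by simp))
    rwa [sub_self] at this)
  intro τ hτ
  have h1 := hC τ (by rwa [uIcc_of_le htT])
  have h2 := hC t (by simp)
  simp only [Pi.sub_apply, intervalIntegral.integral_same, sub_zero] at h1 h2
  rw [h2, ← h1]; abel

/-- uniform absolute continuity of the integral -/
lemma unif_int {g : ℝ → ℝ} {T : ℝ} (hT : 0 ≤ T) (hg : IntegrableOn g (Icc 0 T) volume) {δ : ℝ} (hδ : 0 < δ) :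
    ∃ ρ > 0, ∀ a b, 0 ≤ a → a ≤ b → b ≤ T → b - a ≤ ρ → |∫ ξ in a..b, g ξ| ≤ δ := by
  have hgi : IntervalIntegrable g volume 0 T := (intervalIntegrable_iff_integrableOn_Icc_of_le hT).2 hg
  have hc := intervalIntegral.continuousOn_primitive_interval (a := 0) (b := T) (μ := volume) (f := g)
    (by rwa [uIcc_of_le hT])
  rw [uIcc_of_le hT] at hc
  have hu := isCompact_Icc.uniformContinuousOn_of_continuous hc
  rw [Metric.uniformContinuousOn_iff_le] at hu
  obtain ⟨ρ, hρ, h⟩ := hu δ hδ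
  refine ⟨ρ, hρ, fun a b ha hab hb hba => ?_⟩
  have := h b ⟨ha.trans hab, hb⟩ a ⟨ha, hab.trans hb⟩ (by rw [Real.dist_eq, abs_of_nonneg] <;> linarith)
  rwa [Real.dist_eq, intervalIntegral.integral_interval_sub_left] at this
  · exact hgi.mono_set (by rw [uIcc_of_le (ha.trans hab), uIcc_of_le hT]; exact Icc_subset_Icc_right hb)
  · exact hgi.mono_set (by rw [uIcc_of_le ha, uIcc_of_le hT]; exact Icc_subset_Icc_right (hab.trans hb))

lemma ii_of {g : ℝ → ℝ} {T a b : ℝ} (hg : IntegrableOn g (Icc 0 T) volume)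
    (ha : 0 ≤ a) (hab : a ≤ b) (hb : b ≤ T) : IntervalIntegrable g volume a b :=
  (intervalIntegrable_iff_integrableOn_Icc_of_le hab).2 (hg.mono_set (Icc_subset_Icc ha hb))



set_option linter.unusedSectionVars false
set_option linter.unusedVariables false

section Paths

variable {n : ℕ} {h T : ℝ} [hT : Fact (0 < T)] [hh : Fact (0 ≤ h)]

lemma stopPath_sub (t : ℝ) (x y : PathSp n h T) :
    stopPath t (x - y) = stopPath t x - stopPath t y := rfl

lemma hcT (h T : ℝ) [hT : Fact (0 < T)] [hh : Fact (0 ≤ h)] : -h ≤ T := by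
  linarith [hT.out, hh.out]

lemma evalP_eq (x : PathSp n h T) (τ : ℝ) : evalP x τ = x (projIcc (-h) T (hcT h T) τ) := by
  unfold evalP; rw [dif_pos (hcT h T)]

lemma evalP_coe (x : PathSp n h T) (u : Icc (-h) T) : evalP x u.1 = x u := by
  rw [evalP_eq, projIcc_val]

lemma evalP_sub (x y : PathSp n h T) (τ : ℝ) : evalP (x - y) τ = evalP x τ - evalP y τ := by
  simp [evalP_eq]

lemma evalP_stop {t : ℝ} (ht : 0 ≤ t) (x : PathSp n h T) (τ : ℝ) :
    evalP (stopPath t x) τ = evalP x (min τ t) := by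
  rw [evalP_eq, evalP_eq]
  unfold stopPath
  simp only [ContinuousMap.comp_apply, ContinuousMap.coe_mk]
  congr 1
  apply Subtype.ext
  have h1 := hcT h T
  have h2 := hh.out
  simp only [stopTime, coe_projIcc]
  rcases le_total T τ with h3 | h3 <;> rcases le_total τ t with h4 | h4 <;>
    rcases le_total (-h) τ with h5 | h5 <;> rcases le_total T t with h6 | h6 <;>
    simp [*] <;> grind

lemma continuous_evalP (x : PathSp n h T) : Continuous (evalP x) := by
  have : evalP x = fun τ => x (projIcc (-h) T (hcT h T) τ) := funext (evalP_eq x)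
  rw [this]
  exact x.continuous.comp continuous_projIcc

lemma path_ext {x y : PathSp n h T} (H : ∀ τ, -h ≤ τ → τ ≤ T → evalP x τ = evalP y τ) : x = y := by
  ext1 u
  rw [← evalP_coe, ← evalP_coe]
  exact H _ u.2.1 u.2.2

lemma norm_evalP_le (x : PathSp n h T) (τ : ℝ) : ‖evalP x τ‖ ≤ ‖x‖ := by
  rw [evalP_eq]; exact x.norm_coe_le_norm _

lemma path_norm_le {x : PathSp n h T} {B : ℝ} (hB : 0 ≤ B)
    (H : ∀ τ, -h ≤ τ → τ ≤ T → ‖evalP x τ‖ ≤ B) : ‖x‖ ≤ B := by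
  rw [ContinuousMap.norm_le _ hB]
  intro u
  rw [← evalP_coe]
  exact H _ u.2.1 u.2.2

lemma stop_stop {s t : ℝ} (hs : 0 ≤ s) (ht : 0 ≤ t) (x : PathSp n h T) :
    stopPath s (stopPath t x) = stopPath (min s t) x := by
  apply path_ext
  intro τ _ _
  rw [evalP_stop hs, evalP_stop ht, evalP_stop (le_min hs ht), min_assoc]

lemma stop_T (x : PathSp n h T) : stopPath T x = x := by
  apply path_ext
  intro τ _ h2
  rw [evalP_stop hT.out.le, min_eq_left h2]

lemma norm_stop_le (t : ℝ) (x : PathSp n h T) : ‖stopPath t x‖ ≤ ‖x‖ := by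
  rw [ContinuousMap.norm_le _ (norm_nonneg _)]
  intro u
  exact x.norm_coe_le_norm _

lemma norm_stop_mono {s t : ℝ} (hs : 0 ≤ s) (hst : s ≤ t) (x : PathSp n h T) :
    ‖stopPath s x‖ ≤ ‖stopPath t x‖ := by
  have := stop_stop hs (hs.trans hst) x
  rw [min_eq_left hst] at this
  rw [← this]; exact norm_stop_le _ _

lemma norm_eval_le_stop {τ t : ℝ} (ht : 0 ≤ t) (hτ : τ ≤ t) (x : PathSp n h T) :
    ‖evalP x τ‖ ≤ ‖stopPath t x‖ := by
  have := norm_evalP_le (stopPath t x) τ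
  rwa [evalP_stop ht, min_eq_left hτ] at this

lemma stop_norm_le {x : PathSp n h T} {t B : ℝ} (ht : 0 ≤ t) (hB : 0 ≤ B)
    (H : ∀ τ, -h ≤ τ → τ ≤ t → ‖evalP x τ‖ ≤ B) : ‖stopPath t x‖ ≤ B := by
  refine path_norm_le hB fun τ h1 h2 => ?_
  rw [evalP_stop ht]
  exact H _ (le_min h1 (by linarith [hh.out])) (min_le_right _ _)

lemma stop_ext {x y : PathSp n h T} {t : ℝ} (ht : 0 ≤ t)
    (H : ∀ τ, -h ≤ τ → τ ≤ t → evalP x τ = evalP y τ) : stopPath t x = stopPath t y := by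
  apply path_ext
  intro τ h1 h2
  rw [evalP_stop ht, evalP_stop ht]
  exact H _ (le_min h1 (by linarith [hh.out])) (min_le_right _ _)

lemma stop_eval {x y : PathSp n h T} {t τ : ℝ} (ht : 0 ≤ t) (hτ : τ ≤ t)
    (H : stopPath t x = stopPath t y) : evalP x τ = evalP y τ := by
  have := congrArg (fun z => evalP z τ) H
  simpa [evalP_stop ht, min_eq_left hτ] using this

lemma stop_eq_mono {x y : PathSp n h T} {s t : ℝ} (hs : 0 ≤ s) (hst : s ≤ t)
    (H : stopPath t x = stopPath t y) : stopPath s x = stopPath s y := by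
  have := congrArg (stopPath s) H
  rwa [stop_stop hs (hs.trans hst), stop_stop hs (hs.trans hst), min_eq_left hst] at this

lemma continuous_stop : Continuous (fun p : ℝ × PathSp n h T => stopPath p.1 p.2) := by
  have h1 : Continuous (fun p : ℝ × Icc (-h) T => stopTime h T p.1 p.2) := by
    unfold stopTime
    refine Continuous.subtype_mk ?_ _
    fun_prop
  have h2 : Continuous (fun t : ℝ => (⟨stopTime h T t, continuous_stopTime h T t⟩ : C(Icc (-h) T, Icc (-h) T))) :=
    ContinuousMap.continuous_of_continuous_uncurry _ h1
  unfold stopPath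
  exact continuous_snd.compCM (h2.comp continuous_fst)

lemma continuous_stop_t (x : PathSp n h T) : Continuous (fun t : ℝ => stopPath t x) :=
  continuous_stop.comp (by fun_prop : Continuous fun t : ℝ => (t, x))

lemma continuous_stop_x (t : ℝ) : Continuous (fun x : PathSp n h T => stopPath t x) :=
  continuous_stop.comp (by fun_prop : Continuous fun x : PathSp n h T => (t, x))

/-- velocity bound -/
def Wt (c : ℝ → ℝ) (y : PathSp n h T) (ξ : ℝ) : ℝ := c ξ * (1 + ‖stopPath ξ y‖)

lemma Wt_int {c : ℝ → ℝ} (hc : IntegNonneg T c) (y : PathSp n h T) :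
    IntegrableOn (Wt c y) (Icc 0 T) volume := by
  unfold Wt
  refine IntegrableOn.mul_continuousOn hc.1 ?_ isCompact_Icc
  exact (continuous_const.add (continuous_stop_t y).norm).continuousOn

lemma Wt_nonneg {c : ℝ → ℝ} (hc : IntegNonneg T c) (y : PathSp n h T) {ξ : ℝ} (hξ : ξ ∈ Icc 0 T) :
    0 ≤ Wt c y ξ := mul_nonneg (hc.2 ξ hξ) (by positivity)

/-- admissible continuations, described by an integral inequality -/
def Ad (c : ℝ → ℝ) (t : ℝ) (x : PathSp n h T) : Set (PathSp n h T) :=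
  {y | stopPath t y = stopPath t x ∧ ∀ a b, t ≤ a → a ≤ b → b ≤ T →
    ‖evalP y b - evalP y a‖ ≤ ∫ ξ in a..b, Wt c y ξ}

lemma Ad_pair {c : ℝ → ℝ} (hc : IntegNonneg T c) {t : ℝ} (ht : 0 ≤ t) (htT : t ≤ T)
    {x y : PathSp n h T} (hy : y ∈ Ad c t x) : ∃ v, (y, v) ∈ YPair t x c := by
  obtain ⟨v, hv1, hv2, hv3⟩ := exists_vel (f := evalP y) htT (ii_of (Wt_int hc y) ht htT le_rfl) hy.2
  exact ⟨v, ⟨hy.1, hv1, hv2⟩, hv3⟩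

lemma Ad_self {c : ℝ → ℝ} (hc : IntegNonneg T c) {t : ℝ} (ht : 0 ≤ t)
    (x : PathSp n h T) : stopPath t x ∈ Ad c t x := by
  refine ⟨by rw [stop_stop ht ht, min_self], fun a b ha hab hb => ?_⟩
  rw [evalP_stop ht, evalP_stop ht, min_eq_right ha, min_eq_right (ha.trans hab), sub_self, norm_zero]
  exact intervalIntegral.integral_nonneg hab fun u hu =>
    Wt_nonneg hc _ ⟨ht.trans (ha.trans hu.1), hu.2.trans hb⟩

lemma Ad_congr {c : ℝ → ℝ} {t : ℝ} {x x' : PathSp n h T} (hx : stopPath t x = stopPath t x') :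
    Ad c t x = Ad c t x' := by unfold Ad; rw [hx]

lemma Ad_down {c : ℝ → ℝ} {t t' : ℝ} {x y : PathSp n h T} (ht' : 0 ≤ t') (htt : t' ≤ t)
    (hy : y ∈ Ad c t x) : Ad c t' y = Ad c t' x :=
  Ad_congr (stop_eq_mono ht' htt hy.1)

lemma Ad_concat {c : ℝ → ℝ} (hc : IntegNonneg T c) {t τ : ℝ} (ht : 0 ≤ t) (htτ : t ≤ τ)
    {x y z : PathSp n h T} (hy : y ∈ Ad c t x) (hz : z ∈ Ad c τ y) : z ∈ Ad c t x := by
  refine ⟨(stop_eq_mono ht htτ hz.1).trans hy.1, ?_⟩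
  have h0 : 0 ≤ τ := ht.trans htτ
  have A : ∀ a b, t ≤ a → a ≤ b → b ≤ τ → b ≤ T →
      ‖evalP z b - evalP z a‖ ≤ ∫ ξ in a..b, Wt c z ξ := by
    intro a b ha hab hb hbT
    rw [stop_eval h0 hb hz.1, stop_eval h0 (hab.trans hb) hz.1]
    refine (hy.2 a b ha hab hbT).trans (le_of_eq ?_)
    refine intervalIntegral.integral_congr fun ξ hξ => ?_
    rw [uIcc_of_le hab] at hξ
    simp only [Wt]
    rw [stop_eq_mono (ht.trans (ha.trans hξ.1)) (hξ.2.trans hb) hz.1]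
  intro a b ha hab hb
  rcases le_total b τ with h1 | h1
  · exact A a b ha hab h1 hb
  rcases le_total τ a with h2 | h2
  · exact hz.2 a b h2 hab hb
  have i1 := A a τ ha h2 le_rfl (h1.trans hb)
  have i2 := hz.2 τ b le_rfl h1 hb
  rw [← intervalIntegral.integral_add_adjacent_intervals (b := τ)
    (ii_of (Wt_int hc z) (ht.trans ha) h2 (h1.trans hb)) (ii_of (Wt_int hc z) h0 h1 hb)]
  calc ‖evalP z b - evalP z a‖ = ‖(evalP z τ - evalP z a) + (evalP z b - evalP z τ)‖ := by
        congr 1; abel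
    _ ≤ _ := (norm_add_le _ _).trans (add_le_add i1 i2)

lemma continuous_evalP_x (τ : ℝ) : Continuous (fun x : PathSp n h T => evalP x τ) := by
  have : (fun x : PathSp n h T => evalP x τ) = fun x => x (projIcc (-h) T (hcT h T) τ) :=
    funext fun x => evalP_eq x τ
  rw [this]
  exact continuous_eval_const _

lemma Ad_closed {c : ℝ → ℝ} (hc : IntegNonneg T c) {t : ℝ} (ht : 0 ≤ t)
    (x : PathSp n h T) : IsClosed (Ad c t x) := by
  have : Ad c t x = {y | stopPath t y = stopPath t x} ∩ ⋂ a : ℝ, ⋂ b : ℝ, ⋂ _ : t ≤ a, ⋂ _ : a ≤ b,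
      ⋂ _ : b ≤ T, {y : PathSp n h T | ‖evalP y b - evalP y a‖ ≤ ∫ ξ in a..b, Wt c y ξ} := by
    ext y; simp [Ad]
  rw [this]
  refine (isClosed_eq (continuous_stop_x t) continuous_const).inter ?_
  refine isClosed_iInter fun a => isClosed_iInter fun b => isClosed_iInter fun ha =>
    isClosed_iInter fun hab => isClosed_iInter fun hb => ?_
  refine isClosed_le ((continuous_evalP_x b).sub (continuous_evalP_x a)).norm ?_
  have hci := ii_of hc.1 (ht.trans ha) hab hb
  rw [continuous_iff_continuousAt]
  intro y₀
  rw [Metric.continuousAt_iff]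
  intro ε hε
  set K := ∫ ξ in a..b, c ξ with hK
  have hc0 : ∀ u ∈ Icc a b, 0 ≤ c u := fun u hu => hc.2 u ⟨ht.trans (ha.trans hu.1), hu.2.trans hb⟩
  have hK0 : 0 ≤ K := intervalIntegral.integral_nonneg hab hc0
  refine ⟨ε / (K + 1), by positivity, fun {y} hy => ?_⟩
  have w1 := ii_of (Wt_int hc y) (ht.trans ha) hab hb
  have w0 := ii_of (Wt_int hc y₀) (ht.trans ha) hab hb
  rw [Real.dist_eq, ← intervalIntegral.integral_sub w1 w0, ← Real.norm_eq_abs]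
  have : ‖∫ ξ in a..b, (Wt c y ξ - Wt c y₀ ξ)‖ ≤ ∫ ξ in a..b, c ξ * dist y y₀ := by
    refine intervalIntegral.norm_integral_le_of_norm_le hab ?_ (hci.mul_const _)
    refine Eventually.of_forall fun u hu => ?_
    have hcu := hc0 u ⟨hu.1.le, hu.2⟩
    have : Wt c y u - Wt c y₀ u = c u * (‖stopPath u y‖ - ‖stopPath u y₀‖) := by unfold Wt; ring
    rw [this, norm_mul, Real.norm_of_nonneg hcu]
    refine mul_le_mul_of_nonneg_left ?_ hcu
    refine (abs_norm_sub_norm_le _ _).trans ?_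
    rw [← stopPath_sub, dist_eq_norm]
    exact norm_stop_le _ _
  refine this.trans_lt ?_
  rw [intervalIntegral.integral_mul_const, ← hK]
  calc K * dist y y₀ ≤ (K + 1) * dist y y₀ := by gcongr; linarith
    _ < (K + 1) * (ε / (K + 1)) := by gcongr
    _ = ε := by field_simp

end Paths


section Compactness
open scoped Pointwise

variable {n : ℕ} {h T : ℝ} [hT : Fact (0 < T)] [hh : Fact (0 ≤ h)]

lemma compact_of_modulus {X : Type*} [TopologicalSpace X] {G : X → ℝ} (hG : Continuous G) (R : ℝ) :
    IsCompact {z : C(X, Euc n) | (∀ u, ‖z u‖ ≤ R) ∧ ∀ u v, ‖z u - z v‖ ≤ |G u - G v|} := by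
  apply ArzelaAscoli.isCompact_of_equicontinuous
  · have : ContinuousMap.toFun '' {z : C(X, Euc n) | (∀ u, ‖z u‖ ≤ R) ∧ ∀ u v, ‖z u - z v‖ ≤ |G u - G v|}
        = {f : X → Euc n | (∀ u, ‖f u‖ ≤ R) ∧ ∀ u v, ‖f u - f v‖ ≤ |G u - G v|} := by
      ext f
      constructor
      · rintro ⟨z, hz, rfl⟩; exact hz
      · intro hf
        refine ⟨⟨f, ?_⟩, hf, rfl⟩
        rw [continuous_iff_continuousAt]
        intro u
        have h1 : Tendsto (fun v => |G v - G u|) (𝓝 u) (𝓝 0) := by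
          have : Tendsto (fun v => |G v - G u|) (𝓝 u) (𝓝 (|G u - G u|)) :=
            ((hG.sub continuous_const).abs).tendsto u
          simpa using this
        rw [ContinuousAt, tendsto_iff_norm_sub_tendsto_zero]
        exact squeeze_zero (fun _ => norm_nonneg _) (fun v => hf.2 v u) h1
    rw [this]
    refine IsCompact.of_isClosed_subset (isCompact_univ_pi fun u : X => isCompact_closedBall (0 : Euc n) R) ?_ ?_
    · simp only [ofPred_and, ofPred_forall]
      refine (isClosed_iInter fun u => ?_).inter (isClosed_iInter fun u => isClosed_iInter fun v => ?_)
      · exact isClosed_le (continuous_apply u).norm continuous_const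
      · exact isClosed_le ((continuous_apply u).sub (continuous_apply v)).norm continuous_const
    · intro f hf u _
      simpa using hf.1 u
  · intro u
    refine Metric.equicontinuousAt_of_continuity_modulus (fun v => |G u - G v|) ?_ _ ?_
    · have : Tendsto (fun v => |G u - G v|) (𝓝 u) (𝓝 (|G u - G u|)) :=
        ((continuous_const.sub hG).abs).tendsto u
      simpa using this
    · refine Eventually.of_forall fun v z => ?_
      rw [dist_eq_norm]
      exact z.2.2 u v

lemma Wt_le {c : ℝ → ℝ} (hc : IntegNonneg T c) {y : PathSp n h T} {a b R : ℝ} (ha : 0 ≤ a) (hab : a ≤ b)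
    (hb : b ≤ T) (hR : ‖stopPath b y‖ ≤ R) :
    ∫ ξ in a..b, Wt c y ξ ≤ (1 + R) * ∫ ξ in a..b, c ξ := by
  rw [← intervalIntegral.integral_const_mul]
  refine intervalIntegral.integral_mono_on hab (ii_of (Wt_int hc y) ha hab hb)
    ((ii_of hc.1 ha hab hb).const_mul _) fun u hu => ?_
  unfold Wt
  rw [mul_comm]
  refine mul_le_mul_of_nonneg_right ?_ (hc.2 u ⟨ha.trans hu.1, hu.2.trans hb⟩)
  have := norm_stop_mono (ha.trans hu.1) hu.2 y
  linarith

lemma Ad_bound {c : ℝ → ℝ} (hc : IntegNonneg T c) :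
    ∃ K : ℝ, 0 ≤ K ∧ ∀ t (x y : PathSp n h T), 0 ≤ t → t ≤ T → y ∈ Ad c t x → 1 + ‖y‖ ≤ K * (1 + ‖x‖) := by
  obtain ⟨ρ, hρ, hρc⟩ := unif_int hT.out.le hc.1 (δ := 1/2) (by norm_num)
  obtain ⟨N, hN⟩ := exists_nat_ge (T / ρ)
  rw [div_le_iff₀ hρ] at hN
  refine ⟨2 ^ N, by positivity, fun t x y ht htT hy => ?_⟩
  have step : ∀ a b, t ≤ a → a ≤ b → b ≤ T → b - a ≤ ρ →
      1 + ‖stopPath b y‖ ≤ 2 * (1 + ‖stopPath a y‖) := by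
    intro a b ha hab hb hba
    have ha0 := ht.trans ha
    have : ‖stopPath b y‖ ≤ ‖stopPath a y‖ + (1 + ‖stopPath b y‖) / 2 := by
      refine stop_norm_le (ha0.trans hab) (by positivity) fun τ h1 h2 => ?_
      rcases le_total τ a with h3 | h3
      · have := norm_eval_le_stop ha0 h3 y
        have : 0 ≤ (1 + ‖stopPath b y‖) / 2 := by positivity
        linarith
      · have e1 := hy.2 a τ ha h3 (h2.trans hb)
        have e2 := Wt_le hc ha0 h3 (h2.trans hb) (norm_stop_mono (ha0.trans h3) h2 y)
        have e3 := (le_abs_self _).trans (hρc a τ ha0 h3 (h2.trans hb) (by linarith))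
        have e4 : (1 + ‖stopPath b y‖) * ∫ ξ in a..τ, c ξ ≤ (1 + ‖stopPath b y‖) * (1/2) := by gcongr
        have e5 := norm_eval_le_stop ha0 le_rfl y
        have e6 : ‖evalP y τ‖ ≤ ‖evalP y τ - evalP y a‖ + ‖evalP y a‖ := by
          simpa using norm_add_le (evalP y τ - evalP y a) (evalP y a)
        linarith
    linarith
  have ind : ∀ j : ℕ, ∀ b, t ≤ b → b ≤ T → b ≤ t + j * ρ →
      1 + ‖stopPath b y‖ ≤ 2 ^ j * (1 + ‖stopPath t y‖) := by
    intro j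
    induction j with
    | zero =>
      intro b h1 h2 h3
      have : b = t := by simp at h3; linarith
      subst this; simp
    | succ j ih =>
      intro b h1 h2 h3
      push_cast at h3
      have i1 := ih (max t (b - ρ)) (le_max_left _ _) (max_le htT (by linarith))
        (max_le (by have : 0 ≤ (j:ℝ) * ρ := by positivity
                    linarith) (by linarith))
      have i2 := step (max t (b - ρ)) b (le_max_left _ _) (max_le h1 (by linarith)) h2
        (by linarith [le_max_right t (b - ρ)])
      rw [pow_succ]
      linarith
  have := ind N T htT le_rfl (by linarith)
  rw [stop_T, hy.1] at this
  refine this.trans ?_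
  have := norm_stop_le t x
  gcongr

/-- the reachable set -/
def Reach (c : ℝ → ℝ) (D : Set (PathSp n h T)) : Set (PathSp n h T) :=
  {y | ∃ t ∈ Icc (0:ℝ) T, ∃ x ∈ D, y ∈ Ad c t x}

lemma Reach_self {c : ℝ → ℝ} (hc : IntegNonneg T c) {D : Set (PathSp n h T)} {x : PathSp n h T} (hx : x ∈ D) :
    x ∈ Reach c D := by
  refine ⟨T, ⟨hT.out.le, le_rfl⟩, x, hx, ?_⟩
  have := Ad_self hc hT.out.le x
  rwa [stop_T] at this

lemma Reach_inv {c : ℝ → ℝ} (hc : IntegNonneg T c) {D : Set (PathSp n h T)} {y z : PathSp n h T}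
    (hy : y ∈ Reach c D) {t : ℝ} (ht : t ∈ Icc (0:ℝ) T) (hz : z ∈ Ad c t y) : z ∈ Reach c D := by
  obtain ⟨t', ht', x, hx, hyx⟩ := hy
  rcases le_total t' t with h1 | h1
  · exact ⟨t', ht', x, hx, Ad_concat hc ht'.1 h1 hyx hz⟩
  · exact ⟨t, ht, x, hx, by rwa [Ad_down ht.1 h1 hyx] at hz⟩

lemma Reach_stop {c : ℝ → ℝ} (hc : IntegNonneg T c) {D : Set (PathSp n h T)} {y : PathSp n h T}
    (hy : y ∈ Reach c D) {t : ℝ} (ht : t ∈ Icc (0:ℝ) T) : stopPath t y ∈ Reach c D :=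
  Reach_inv hc hy ht (Ad_self hc ht.1 y)

lemma Reach_compact {c : ℝ → ℝ} (hc : IntegNonneg T c) {D₀ : Set (PathSp n h T)} (hD : IsCompact D₀) :
    ∃ D : Set (PathSp n h T), IsCompact D ∧ Reach c D₀ ⊆ D := by
  obtain ⟨K, hK0, hK⟩ := Ad_bound (n := n) (h := h) hc
  obtain ⟨R₀, hR₀⟩ := hD.isBounded.exists_norm_le
  set R := K * (1 + |R₀|) with hR
  have hR0 : 0 ≤ R := by positivity
  set G : Icc (-h) T → ℝ := fun u => (1 + R) * ∫ ξ in (0:ℝ)..(max 0 u.1), c ξ with hGdef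
  have hGc : Continuous G := by
    refine continuous_const.mul ?_
    have hc1 := intervalIntegral.continuousOn_primitive_interval (a := 0) (b := T) (μ := volume) (f := c)
      (by rw [uIcc_of_le hT.out.le]; exact hc.1)
    rw [uIcc_of_le hT.out.le] at hc1
    refine hc1.comp_continuous (by fun_prop) fun u => ⟨le_max_left _ _, max_le hT.out.le u.2.2⟩
  refine ⟨((fun p : ℝ × PathSp n h T => stopPath p.1 p.2) '' (Icc 0 T ×ˢ D₀)) +
    {z : C(Icc (-h) T, Euc n) | (∀ u, ‖z u‖ ≤ 2 * R) ∧ ∀ u v, ‖z u - z v‖ ≤ |G u - G v|},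
    ((isCompact_Icc.prod hD).image continuous_stop).add (compact_of_modulus hGc _), ?_⟩
  rintro y ⟨t, ht, x, hx, hy⟩
  have hyR : ‖y‖ ≤ R := by
    have h1 := hK t x y ht.1 ht.2 hy
    have h2 : K * (1 + ‖x‖) ≤ R := by
      rw [hR]
      have := (hR₀ x hx).trans (le_abs_self _)
      gcongr
    linarith
  refine Set.mem_add.2 ⟨stopPath t x, ⟨(t, x), ⟨ht, hx⟩, rfl⟩, y - stopPath t y, ⟨?_, ?_⟩, ?_⟩
  · intro u
    have := ContinuousMap.norm_coe_le_norm (y - stopPath t y) u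
    have h2 := norm_sub_le y (stopPath t y)
    have h3 := norm_stop_le t y
    linarith
  · have key : ∀ u v : Icc (-h) T, u ≤ v →
        ‖(y - stopPath t y) v - (y - stopPath t y) u‖ ≤ |G v - G u| := by
      intro u v huv
      have huv' : u.1 ≤ v.1 := huv
      rw [← evalP_coe, ← evalP_coe, evalP_sub, evalP_sub, evalP_stop ht.1, evalP_stop ht.1]
      have hGs : G v - G u = (1 + R) * ∫ ξ in (max 0 u.1)..(max 0 v.1), c ξ := by
        simp only [hGdef]
        rw [← mul_sub, intervalIntegral.integral_interval_sub_left]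
        · exact ii_of hc.1 le_rfl (le_max_left _ _) (max_le hT.out.le v.2.2)
        · exact ii_of hc.1 le_rfl (le_max_left _ _) (max_le hT.out.le u.2.2)
      rw [hGs]
      rcases le_total v.1 t with h1 | h1
      · rw [min_eq_left h1, min_eq_left (huv'.trans h1)]; simp; positivity
      rw [min_eq_right h1]
      have e0 : evalP y v - evalP y t - (evalP y u - evalP y (min u.1 t)) =
          evalP y v - evalP y (max u.1 t) := by
        rcases le_total u.1 t with h2 | h2
        · rw [min_eq_left h2, max_eq_right h2]; abel
        · rw [min_eq_right h2, max_eq_left h2]; abel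
      rw [e0]
      have hmv : max u.1 t ≤ v.1 := max_le huv' h1
      have hm0 : 0 ≤ max u.1 t := ht.1.trans (le_max_right _ _)
      refine (hy.2 _ _ (le_max_right _ _) hmv v.2.2).trans ?_
      refine (Wt_le hc hm0 hmv v.2.2 ((norm_stop_le _ _).trans hyR)).trans (le_trans ?_ (le_abs_self _))
      refine mul_le_mul_of_nonneg_left ?_ (by positivity)
      have hv0 : 0 ≤ v.1 := hm0.trans hmv
      rw [max_eq_right hv0]
      refine intervalIntegral.integral_mono_interval (max_le hm0 (le_max_left _ _)) hmv le_rfl ?_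
        (ii_of hc.1 (le_max_left _ _) (max_le hv0 huv') v.2.2)
      refine (ae_restrict_iff' measurableSet_Ioc).2 (Eventually.of_forall fun ξ hξ => ?_)
      exact hc.2 ξ ⟨(le_max_left _ _).trans hξ.1.le, hξ.2.trans v.2.2⟩
    intro u v
    rcases le_total u v with h1 | h1
    · rw [norm_sub_rev, abs_sub_comm]; exact key u v h1
    · exact key v u h1
  · rw [hy.1]; abel

lemma Reach_bdd {c : ℝ → ℝ} (hc : IntegNonneg T c) {D₀ : Set (PathSp n h T)} (hD : IsCompact D₀) :
    ∃ R : ℝ, 0 ≤ R ∧ ∀ y ∈ Reach c D₀, ‖y‖ ≤ R := by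
  obtain ⟨D, hD, hsub⟩ := Reach_compact hc hD
  obtain ⟨R₀, hR₀⟩ := hD.isBounded.exists_norm_le
  exact ⟨|R₀|, abs_nonneg _, fun y hy => (hR₀ y (hsub hy)).trans (le_abs_self _)⟩

lemma Ad_compact {c : ℝ → ℝ} (hc : IntegNonneg T c) {t : ℝ} (ht : t ∈ Icc (0:ℝ) T) (x : PathSp n h T) :
    IsCompact (Ad c t x) := by
  obtain ⟨D, hD, hsub⟩ := Reach_compact hc (isCompact_singleton (x := x))
  exact hD.of_isClosed_subset (Ad_closed hc ht.1 x) fun y hy => hsub ⟨t, ht, x, rfl, hy⟩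

end Compactness


section SysSec

variable {n : ℕ} {h T : ℝ} [hT : Fact (0 < T)] [hh : Fact (0 ≤ h)]

lemma ae_of_full {E : Set ℝ} {f g : ℝ → ℝ} (hT0 : 0 ≤ T)
    (hf : AEMeasurable f (volume.restrict (Icc 0 T))) (hg : AEMeasurable g (volume.restrict (Icc 0 T)))
    (hE : E ⊆ Icc 0 T) (hE2 : volume E = ENNReal.ofReal T) (hle : ∀ t ∈ E, f t ≤ g t) :
    ∀ᵐ t ∂(volume.restrict (Icc (0:ℝ) T)), f t ≤ g t := by
  rw [ae_iff_measure_eq (nullMeasurableSet_le hf hg)]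
  refine le_antisymm (measure_mono (subset_univ _)) ?_
  rw [Measure.restrict_apply_univ, Real.volume_Icc, sub_zero, ← hE2, Measure.restrict_apply' measurableSet_Icc]
  exact measure_mono fun t ht => ⟨hle t ht, hE ht⟩

/-- working form of the assumptions -/
structure Sys (H : ℝ → PathSp n h T → Euc n → ℝ) (c : ℝ → ℝ) : Prop where
  hc : IntegNonneg T c
  int : ∀ x s, IntegrableOn (fun t => H t x s) (Icc 0 T) volume
  lip : ∀ D : Set (PathSp n h T), IsCompact D → ∃ lam : ℝ → ℝ, IntegNonneg T lam ∧
    ∀ x₁ ∈ D, ∀ x₂ ∈ D, ∀ s : Euc n, ∀ᵐ t ∂(volume.restrict (Icc (0:ℝ) T)),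
      |H t x₁ s - H t x₂ s| ≤ lam t * (1 + ‖s‖) * ‖stopPath t x₁ - stopPath t x₂‖
  c4 : ∀ x s₁ s₂, ∀ᵐ t ∂(volume.restrict (Icc (0:ℝ) T)),
      |H t x s₁ - H t x s₂| ≤ c t * (1 + ‖stopPath t x‖) * ‖s₁ - s₂‖
  bdd : ∀ D : Set (PathSp n h T), IsCompact D → ∃ m : ℝ → ℝ, IntegNonneg T m ∧
    ∀ x ∈ D, ∀ᵐ t ∂(volume.restrict (Icc (0:ℝ) T)), |H t x 0| ≤ m t

lemma Sys.of_cond {H : ℝ → PathSp n h T → Euc n → ℝ} {c : ℝ → ℝ} (hH : CondA H c) : Sys H c := by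
  obtain ⟨h1, h2, h3, ⟨hc, E4, hE4, hE4', h4⟩, h5⟩ := hH
  have hm : ∀ x s, AEMeasurable (fun t => H t x s) (volume.restrict (Icc 0 T)) := fun x s =>
    aemeasurable_restrict_of_measurable_subtype measurableSet_Icc (h1 x s)
  have hmc : AEMeasurable c (volume.restrict (Icc 0 T)) := hc.1.aemeasurable
  have c4 : ∀ x s₁ s₂, ∀ᵐ t ∂(volume.restrict (Icc (0:ℝ) T)),
      |H t x s₁ - H t x s₂| ≤ c t * (1 + ‖stopPath t x‖) * ‖s₁ - s₂‖ := by
    intro x s₁ s₂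
    refine ae_of_full hT.out.le ?_ ?_ hE4 hE4' fun t ht => h4 t ht x s₁ s₂
    · exact ((hm x s₁).sub (hm x s₂)).abs
    · exact (hmc.mul ((continuous_stop_t x).norm.const_add 1 |>.measurable.aemeasurable)).mul_const _
  have bdd : ∀ D : Set (PathSp n h T), IsCompact D → ∃ m : ℝ → ℝ, IntegNonneg T m ∧
      ∀ x ∈ D, ∀ᵐ t ∂(volume.restrict (Icc (0:ℝ) T)), |H t x 0| ≤ m t := by
    intro D hD
    obtain ⟨m, hm1, hm2⟩ := h5 D hD
    refine ⟨m, hm1, fun x hx => ?_⟩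
    obtain ⟨E, hE, hE', hE3⟩ := hm2 x hx
    exact ae_of_full hT.out.le (hm x 0).abs hm1.1.aemeasurable hE hE' hE3
  refine ⟨hc, ?_, ?_, c4, bdd⟩
  · intro x s
    obtain ⟨m, hm1, hm2⟩ := bdd {x} isCompact_singleton
    have hi : IntegrableOn (fun t => Wt c x t * ‖s - 0‖ + m t) (Icc 0 T) volume :=
      ((Wt_int hc x).mul_const _).add hm1.1
    refine Integrable.mono' hi (hm x s).aestronglyMeasurable ?_
    filter_upwards [c4 x s 0, hm2 x rfl] with t ht1 ht2
    unfold Wt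
    rw [Real.norm_eq_abs]
    have : H t x s = (H t x s - H t x 0) + H t x 0 := by ring
    rw [this]
    exact (abs_add_le _ _).trans (by linarith)
  · intro D hD
    obtain ⟨lam, hl1, hl2⟩ := h3 D hD
    refine ⟨lam, hl1, fun x₁ hx₁ x₂ hx₂ s => ?_⟩
    obtain ⟨E, hE, hE', hE3⟩ := hl2 x₁ hx₁ x₂ hx₂ s
    refine ae_of_full hT.out.le ((hm x₁ s).sub (hm x₂ s)).abs ?_ hE hE' hE3
    exact (hl1.1.aemeasurable.mul_const _).mul
      (((continuous_stop_t x₁).sub (continuous_stop_t x₂)).norm.measurable.aemeasurable)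

/-- the reflected Hamiltonian -/
def negH (H : ℝ → PathSp n h T → Euc n → ℝ) : ℝ → PathSp n h T → Euc n → ℝ :=
  fun t x s => - H t x (-s)

lemma Sys.neg {H : ℝ → PathSp n h T → Euc n → ℝ} {c : ℝ → ℝ} (hS : Sys H c) : Sys (negH H) c := by
  refine ⟨hS.hc, fun x s => (hS.int x (-s)).neg, ?_, ?_, ?_⟩
  · intro D hD
    obtain ⟨lam, hl1, hl2⟩ := hS.lip D hD
    refine ⟨lam, hl1, fun x₁ hx₁ x₂ hx₂ s => ?_⟩
    filter_upwards [hl2 x₁ hx₁ x₂ hx₂ (-s)] with t ht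
    rw [norm_neg] at ht
    unfold negH
    rwa [neg_sub_neg, abs_sub_comm]
  · intro x s₁ s₂
    filter_upwards [hS.c4 x (-s₁) (-s₂)] with t ht
    unfold negH
    rw [neg_sub_neg, abs_sub_comm]
    rwa [neg_sub_neg, norm_sub_rev] at ht
  · intro D hD
    obtain ⟨m, hm1, hm2⟩ := hS.bdd D hD
    refine ⟨m, hm1, fun x hx => ?_⟩
    filter_upwards [hm2 x hx] with t ht
    unfold negH
    rwa [abs_neg, neg_zero]

/-- integral of the Hamiltonian along a path -/
def II (H : ℝ → PathSp n h T → Euc n → ℝ) (a b : ℝ) (y : PathSp n h T) (s : Euc n) : ℝ :=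
  ∫ ξ in a..b, H ξ y s

lemma II_neg (H : ℝ → PathSp n h T → Euc n → ℝ) (a b : ℝ) (y : PathSp n h T) (s : Euc n) :
    II (negH H) a b y s = - II H a b y (-s) := by
  unfold II negH; rw [intervalIntegral.integral_neg]

lemma II_add {H : ℝ → PathSp n h T → Euc n → ℝ} {c : ℝ → ℝ} (hS : Sys H c) {a b d : ℝ} (ha : 0 ≤ a)
    (hab : a ≤ b) (hbd : b ≤ d) (hd : d ≤ T) (y : PathSp n h T) (s : Euc n) :
    II H a b y s + II H b d y s = II H a d y s :=
  intervalIntegral.integral_add_adjacent_intervals (ii_of (hS.int y s) ha hab (hbd.trans hd))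
    (ii_of (hS.int y s) (ha.trans hab) hbd hd)

lemma ae_Icc_sub {p : ℝ → Prop} {a b : ℝ} (ha : 0 ≤ a) (hb : b ≤ T)
    (hp : ∀ᵐ t ∂(volume.restrict (Icc (0:ℝ) T)), p t) : ∀ᵐ t ∂(volume.restrict (Icc a b)), p t :=
  ae_restrict_of_ae_restrict_of_subset (Icc_subset_Icc ha hb) hp

/-- bounding an interval integral by an a.e. bound -/
lemma abs_int_le {f g : ℝ → ℝ} {a b : ℝ} (ha : 0 ≤ a) (hab : a ≤ b) (hb : b ≤ T)
    (hg : IntegrableOn g (Icc 0 T) volume)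
    (hp : ∀ᵐ t ∂(volume.restrict (Icc a b)), |f t| ≤ g t) : |∫ ξ in a..b, f ξ| ≤ ∫ ξ in a..b, g ξ := by
  rw [← Real.norm_eq_abs]
  refine intervalIntegral.norm_integral_le_of_norm_le hab ?_ (ii_of hg ha hab hb)
  have := (ae_restrict_iff' measurableSet_Icc).1 hp
  filter_upwards [this] with t ht ht2
  exact ht ⟨ht2.1.le, ht2.2⟩

lemma int_nonneg {g : ℝ → ℝ} (hg : IntegNonneg T g) {a b : ℝ} (ha : 0 ≤ a) (hab : a ≤ b) (hb : b ≤ T) :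
    0 ≤ ∫ ξ in a..b, g ξ :=
  intervalIntegral.integral_nonneg hab fun u hu => hg.2 u ⟨ha.trans hu.1, hu.2.trans hb⟩

lemma int_split {g : ℝ → ℝ} (hg : IntegNonneg T g) {a b d : ℝ} (ha : 0 ≤ a) (hab : a ≤ b) (hbd : b ≤ d) (hd : d ≤ T) :
    (∫ ξ in a..b, g ξ) + (∫ ξ in b..d, g ξ) = ∫ ξ in a..d, g ξ :=
  intervalIntegral.integral_add_adjacent_intervals (ii_of hg.1 ha hab (hbd.trans hd))
    (ii_of hg.1 (ha.trans hab) hbd hd)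

lemma int_mono {g : ℝ → ℝ} (hg : IntegNonneg T g) {a b a' b' : ℝ} (ha : 0 ≤ a') (haa : a' ≤ a) (hab : a ≤ b)
    (hbb : b ≤ b') (hb : b' ≤ T) :
    (∫ ξ in a..b, g ξ) ≤ ∫ ξ in a'..b', g ξ := by
  have h1 := int_split hg ha haa (hab.trans hbb) hb
  have h2 := int_split hg (ha.trans haa) hab hbb hb
  have h3 := int_nonneg hg ha haa (hab.trans (hbb.trans hb))
  have h4 := int_nonneg hg (ha.trans (haa.trans hab)) hbb hb
  linarith

/-- (I2) -/
lemma II_lip {H : ℝ → PathSp n h T → Euc n → ℝ} {c : ℝ → ℝ} (hS : Sys H c) {D : Set (PathSp n h T)} {lam : ℝ → ℝ}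
    (hl : IntegNonneg T lam)
    (hlip : ∀ x₁ ∈ D, ∀ x₂ ∈ D, ∀ s : Euc n, ∀ᵐ t ∂(volume.restrict (Icc (0:ℝ) T)),
      |H t x₁ s - H t x₂ s| ≤ lam t * (1 + ‖s‖) * ‖stopPath t x₁ - stopPath t x₂‖)
    {a b : ℝ} (ha : 0 ≤ a) (hab : a ≤ b) (hb : b ≤ T) {y₁ y₂ : PathSp n h T} (h1 : y₁ ∈ D) (h2 : y₂ ∈ D) (s : Euc n) :
    |II H a b y₁ s - II H a b y₂ s| ≤ (1 + ‖s‖) * ‖stopPath b (y₁ - y₂)‖ * ∫ ξ in a..b, lam ξ := by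
  unfold II
  rw [← intervalIntegral.integral_sub (ii_of (hS.int _ _) ha hab hb) (ii_of (hS.int _ _) ha hab hb),
    ← intervalIntegral.integral_const_mul]
  refine abs_int_le ha hab hb (hl.1.const_mul _) ?_
  filter_upwards [ae_Icc_sub ha hb (hlip y₁ h1 y₂ h2 s), ae_restrict_mem measurableSet_Icc] with t ht htm
  refine ht.trans ?_
  have e1 := norm_stop_mono (ha.trans htm.1) htm.2 (y₁ - y₂)
  rw [stopPath_sub] at e1
  have e2 := hl.2 t ⟨ha.trans htm.1, htm.2.trans hb⟩
  calc _ = (1 + ‖s‖) * ‖stopPath t y₁ - stopPath t y₂‖ * lam t := by ring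
    _ ≤ _ := by gcongr

lemma II_congr {H : ℝ → PathSp n h T → Euc n → ℝ} {c : ℝ → ℝ} (hS : Sys H c)
    {a b : ℝ} (ha : 0 ≤ a) (hab : a ≤ b) (hb : b ≤ T) {y₁ y₂ : PathSp n h T}
    (hy : stopPath b y₁ = stopPath b y₂) (s : Euc n) : II H a b y₁ s = II H a b y₂ s := by
  obtain ⟨lam, hl, hlip⟩ := hS.lip {y₁, y₂} (by simp)
  have := II_lip hS hl hlip ha hab hb (by simp : y₁ ∈ ({y₁, y₂} : Set (PathSp n h T))) (by simp : y₂ ∈ ({y₁, y₂} : Set (PathSp n h T))) s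
  rw [stopPath_sub, hy, sub_self, norm_zero, mul_zero, zero_mul] at this
  exact sub_eq_zero.1 (abs_eq_zero.1 (le_antisymm this (abs_nonneg _)))

/-- (I3) -/
lemma II_zero {H : ℝ → PathSp n h T → Euc n → ℝ} {D : Set (PathSp n h T)} {m : ℝ → ℝ}
    (hm : IntegNonneg T m) (hb0 : ∀ x ∈ D, ∀ᵐ t ∂(volume.restrict (Icc (0:ℝ) T)), |H t x 0| ≤ m t)
    {a b : ℝ} (ha : 0 ≤ a) (hab : a ≤ b) (hb : b ≤ T) {y : PathSp n h T} (hy : y ∈ D) :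
    |II H a b y 0| ≤ ∫ ξ in a..b, m ξ :=
  abs_int_le ha hab hb hm.1 (ae_Icc_sub ha hb (hb0 y hy))

/-- change of s -/
lemma II_s {H : ℝ → PathSp n h T → Euc n → ℝ} {c : ℝ → ℝ} (hS : Sys H c)
    {a b R : ℝ} (ha : 0 ≤ a) (hab : a ≤ b) (hb : b ≤ T) {y : PathSp n h T} (hy : ‖y‖ ≤ R) (s s' : Euc n) :
    |II H a b y s - II H a b y s'| ≤ ((1 + R) * ∫ ξ in a..b, c ξ) * ‖s - s'‖ := by
  have h1 : |II H a b y s - II H a b y s'| ≤ ∫ ξ in a..b, Wt c y ξ * ‖s - s'‖ := by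
    unfold II
    rw [← intervalIntegral.integral_sub (ii_of (hS.int _ _) ha hab hb) (ii_of (hS.int _ _) ha hab hb)]
    refine abs_int_le ha hab hb ((Wt_int hS.hc y).mul_const _) ?_
    exact ae_Icc_sub ha hb (hS.c4 y s s')
  rw [intervalIntegral.integral_mul_const] at h1
  refine h1.trans ?_
  have := Wt_le hS.hc ha hab hb ((norm_stop_le b y).trans hy)
  gcongr

/-- increments of admissible paths -/
lemma Ad_incr {c : ℝ → ℝ} (hc : IntegNonneg T c) {t a b R : ℝ} {x y : PathSp n h T} (ht : 0 ≤ t) (hy : y ∈ Ad c t x)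
    (hR : ‖y‖ ≤ R) (hta : t ≤ a) (hab : a ≤ b) (hb : b ≤ T) :
    ‖evalP y b - evalP y a‖ ≤ (1 + R) * ∫ ξ in a..b, c ξ :=
  (hy.2 a b hta hab hb).trans (Wt_le hc (ht.trans hta) hab hb ((norm_stop_le b y).trans hR))

/-- sup-norm change over a step -/
lemma stop_incr {z : PathSp n h T} {a b B : ℝ} (ha : 0 ≤ a) (hab : a ≤ b) (hB : 0 ≤ B)
    (H : ∀ τ, a ≤ τ → τ ≤ b → ‖evalP z τ - evalP z a‖ ≤ B) : ‖stopPath b z - stopPath a z‖ ≤ B := by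
  refine path_norm_le hB fun τ _ _ => ?_
  rw [evalP_sub, evalP_stop (ha.trans hab), evalP_stop ha]
  rcases le_total τ a with h1 | h1
  · rw [min_eq_left h1, min_eq_left (h1.trans hab)]; simpa
  · rw [min_eq_right h1]; exact H _ (le_min h1 hab) (min_le_right _ _)

end SysSec


section EulerSec

variable {n : ℕ} {h T : ℝ} [hT : Fact (0 < T)] [hh : Fact (0 ≤ h)]

lemma concat {c : ℝ → ℝ} (hc : IntegNonneg T c) {S : Set (PathSp n h T)}
    (hS : ∀ x ∈ S, ∀ t ∈ Icc (0:ℝ) T, ∀ y ∈ Ad c t x, y ∈ S)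
    {t : ℕ → ℝ} (htm : Monotone t) (ht : ∀ i, t i ∈ Icc (0:ℝ) T)
    {Q : ℕ → PathSp n h T → Prop}
    (hQ : ∀ i y z, stopPath (t (i+1)) y = stopPath (t (i+1)) z → Q i y → Q i z) (N : ℕ)
    (hex : ∀ i < N, ∀ x ∈ S, ∃ y ∈ Ad c (t i) x, Q i y) :
    ∀ x ∈ S, ∃ y ∈ Ad c (t 0) x, ∀ i < N, Q i y := by
  intro x hx
  induction N with
  | zero => exact ⟨_, Ad_self hc (ht 0).1 x, fun i hi => absurd hi (Nat.not_lt_zero _)⟩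
  | succ N ih =>
    obtain ⟨y, hy, hyQ⟩ := ih fun i hi => hex i (by omega)
    obtain ⟨z, hz, hzQ⟩ := hex N (by omega) y (hS x hx _ (ht 0) y hy)
    refine ⟨z, Ad_concat hc (ht 0).1 (htm (Nat.zero_le N)) hy hz, fun i hi => ?_⟩
    rcases Nat.lt_succ_iff_lt_or_eq.1 hi with h1 | h1
    · exact hQ i y z (stop_eq_mono (ht _).1 (htm (by omega : i + 1 ≤ N)) hz.1.symm) (hyQ i h1)
    · subst h1; exact hzQ

lemma euler_step {H : ℝ → PathSp n h T → Euc n → ℝ} {c : ℝ → ℝ} (hS : Sys H c) {S D : Set (PathSp n h T)}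
    (hSi : ∀ x ∈ S, ∀ t ∈ Icc (0:ℝ) T, ∀ y ∈ Ad c t x, y ∈ S) (hSD : S ⊆ D)
    {lam : ℝ → ℝ} (hl : IntegNonneg T lam)
    (hlip : ∀ x₁ ∈ D, ∀ x₂ ∈ D, ∀ s : Euc n, ∀ᵐ t ∂(volume.restrict (Icc (0:ℝ) T)),
      |H t x₁ s - H t x₂ s| ≤ lam t * (1 + ‖s‖) * ‖stopPath t x₁ - stopPath t x₂‖)
    {R : ℝ} (hR0 : 0 ≤ R) (hR : ∀ y ∈ S, ‖y‖ ≤ R)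
    {t τ : ℝ} (ht : 0 ≤ t) (htτ : t ≤ τ) (hτ : τ ≤ T) {x : PathSp n h T} (hx : x ∈ S) (s s' : Euc n) :
    ∃ y ∈ Ad c t x, II H t τ y s - II H t τ y s' ≤ inner ℝ (s - s') (evalP y τ - evalP y t) +
      (2 + ‖s‖ + ‖s'‖) * ((1 + R) * ∫ ξ in t..τ, c ξ) * ∫ ξ in t..τ, lam ξ := by
  have htI : t ∈ Icc 0 T := ⟨ht, htτ.trans hτ⟩
  have hc0 := int_nonneg hS.hc ht htτ hτ
  have hl0 := int_nonneg hl ht htτ hτ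
  set z := stopPath t x with hz
  have hzA : z ∈ Ad c t x := Ad_self hS.hc ht x
  by_cases hss : s = s'
  · refine ⟨z, hzA, ?_⟩
    subst hss
    simp only [sub_self, inner_zero_left, zero_add]
    positivity
  have hn0 : 0 < ‖s - s'‖ := norm_pos_iff.2 (sub_ne_zero.2 hss)
  set q : ℝ → ℝ := fun ξ => H ξ z s - H ξ z s' with hq
  have hqi : IntegrableOn q (Icc 0 T) volume := (hS.int z s).sub (hS.int z s')
  set w : Euc n := (‖s - s'‖ ^ 2)⁻¹ • (s - s') with hw
  have hwn : ‖w‖ = ‖s - s'‖⁻¹ := by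
    rw [hw, norm_smul, norm_inv, norm_pow, norm_norm]; field_simp
  set P : ℝ → ℝ := fun u => ∫ ξ in t..(max t (min u τ)), q ξ with hP
  have hPc : Continuous P := by
    have hc1 := intervalIntegral.continuousOn_primitive_interval (a := t) (b := τ) (μ := volume) (f := q)
      (by rw [uIcc_of_le htτ]; exact hqi.mono_set (Icc_subset_Icc ht hτ))
    rw [uIcc_of_le htτ] at hc1
    exact hc1.comp_continuous (by fun_prop) fun u => ⟨le_max_left _ _, max_le htτ (min_le_right _ _)⟩
  set f : ℝ → Euc n := fun u => evalP x (min u t) + P u • w with hf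
  have hfc : Continuous f := ((continuous_evalP x).comp (by fun_prop)).add (hPc.smul continuous_const)
  set y : PathSp n h T := ⟨fun u => f u.1, hfc.comp continuous_subtype_val⟩ with hy
  have hev : ∀ u, -h ≤ u → u ≤ T → evalP y u = f u := fun u h1 h2 => evalP_coe y ⟨u, h1, h2⟩
  have h00 := hh.out
  have hst : stopPath t y = stopPath t x := by
    refine stop_ext ht fun u h1 h2 => ?_
    rw [hev u h1 (h2.trans htI.2)]
    simp only [hf, hP]
    rw [min_eq_left h2, min_eq_left (h2.trans htτ), max_eq_left h2]
    simp
  have hqb : ∀ᵐ ξ ∂(volume.restrict (Icc t T)), |q ξ| ≤ ‖s - s'‖ * Wt c y ξ := by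
    filter_upwards [ae_Icc_sub ht le_rfl (hS.c4 z s s'), ae_restrict_mem measurableSet_Icc] with ξ h1 h2
    refine h1.trans ?_
    have e1 : ‖stopPath ξ z‖ ≤ ‖stopPath ξ y‖ := by
      refine (norm_stop_le _ _).trans ?_
      rw [hz, ← hst]; exact norm_stop_mono ht h2.1 y
    have e2 := hS.hc.2 ξ ⟨ht.trans h2.1, h2.2⟩
    unfold Wt
    rw [mul_comm]
    gcongr
  have hyA : y ∈ Ad c t x := by
    refine ⟨hst, fun a b ha hab hb => ?_⟩
    have ha0 := ht.trans ha
    have hW := (ii_of (Wt_int hS.hc y) ha0 hab hb)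
    rw [hev a (by linarith) (hab.trans hb), hev b (by linarith) hb]
    simp only [hf]
    rw [min_eq_right ha, min_eq_right (ha.trans hab), add_sub_add_left_eq_sub, ← sub_smul, norm_smul, hwn, Real.norm_eq_abs]
    set a' := max t (min a τ) with ha'
    set b' := max t (min b τ) with hb'
    have k1 : t ≤ a' := le_max_left _ _
    have k2 : a' ≤ b' := max_le_max le_rfl (min_le_min hab le_rfl)
    have k3 : b' ≤ T := max_le htI.2 ((min_le_right _ _).trans hτ)
    have e1 : P b - P a = ∫ ξ in a'..b', q ξ := by
      simp only [hP]
      rw [intervalIntegral.integral_interval_sub_left]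
      · exact ii_of hqi ht (k1.trans k2) k3
      · exact ii_of hqi ht k1 (k2.trans k3)
    rw [e1]
    have e2 : |∫ ξ in a'..b', q ξ| ≤ ∫ ξ in a'..b', ‖s - s'‖ * Wt c y ξ := by
      refine abs_int_le (ht.trans k1) k2 k3 ((Wt_int hS.hc y).const_mul _) ?_
      exact ae_restrict_of_ae_restrict_of_subset (Icc_subset_Icc k1 k3) hqb
    rw [intervalIntegral.integral_const_mul] at e2
    have e3 : ∫ ξ in a'..b', Wt c y ξ ≤ ∫ ξ in a..b, Wt c y ξ := by
      have hWN : IntegNonneg T (Wt c y) := ⟨Wt_int hS.hc y, fun ξ hξ => Wt_nonneg hS.hc y hξ⟩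
      rcases le_total a τ with h1 | h1
      · have : a' = a := by rw [ha', min_eq_left h1, max_eq_right ha]
        rw [this] at k2 ⊢
        refine int_mono hWN ha0 le_rfl k2 (max_le (ha.trans hab) (min_le_left _ _)) hb
      · have h3 : a' = b' := by
          rw [ha', hb', min_eq_right h1, min_eq_right (h1.trans hab)]
        rw [h3, intervalIntegral.integral_same]
        exact int_nonneg hWN ha0 hab hb
    calc |∫ ξ in a'..b', q ξ| * ‖s - s'‖⁻¹ ≤ (‖s - s'‖ * ∫ ξ in a'..b', Wt c y ξ) * ‖s - s'‖⁻¹ := by gcongr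
      _ = ∫ ξ in a'..b', Wt c y ξ := by field_simp
      _ ≤ _ := e3
  refine ⟨y, hyA, ?_⟩
  have hyS := hSi x hx t htI y hyA
  have hzS := hSi x hx t htI z hzA
  have b1 := II_lip hS hl hlip ht htτ hτ (hSD hyS) (hSD hzS) s
  have b2 := II_lip hS hl hlip ht htτ hτ (hSD hyS) (hSD hzS) s'
  have b3 : ‖stopPath τ (y - z)‖ ≤ (1 + R) * ∫ ξ in t..τ, c ξ := by
    have : stopPath τ (y - z) = stopPath τ y - stopPath t y := by
      rw [stopPath_sub, hst, hz, stop_stop (ht.trans htτ) ht, min_eq_right htτ]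
    rw [this]
    refine stop_incr ht htτ (by positivity) fun u h1 h2 => ?_
    refine (Ad_incr hS.hc ht hyA (hR y hyS) le_rfl h1 (h2.trans hτ)).trans ?_
    have := int_mono hS.hc ht le_rfl h1 h2 hτ
    gcongr
  have b4 : inner ℝ (s - s') (evalP y τ - evalP y t) = II H t τ z s - II H t τ z s' := by
    have e1 : evalP y τ - evalP y t = P τ • w := by
      rw [hev τ (by linarith) hτ, hev t (by linarith) htI.2]
      simp only [hf, hP]
      rw [min_eq_right htτ, min_self, min_self, max_eq_right htτ, min_eq_left htτ, max_self]
      simp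
    rw [e1, hw, inner_smul_right, inner_smul_right, real_inner_self_eq_norm_sq, inv_mul_cancel₀ (by positivity), mul_one]
    simp only [hP]
    rw [min_self, max_eq_right htτ]
    unfold II
    rw [← intervalIntegral.integral_sub (ii_of (hS.int _ _) ht htτ hτ) (ii_of (hS.int _ _) ht htτ hτ)]
  rw [b4]
  have c1 := (abs_le.1 b1).2
  have c2 := (abs_le.1 b2).1
  have c3 : (1 + ‖s‖) * ‖stopPath τ (y - z)‖ * ∫ ξ in t..τ, lam ξ ≤
      (1 + ‖s‖) * ((1 + R) * ∫ ξ in t..τ, c ξ) * ∫ ξ in t..τ, lam ξ := by gcongr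
  have c4 : (1 + ‖s'‖) * ‖stopPath τ (y - z)‖ * ∫ ξ in t..τ, lam ξ ≤
      (1 + ‖s'‖) * ((1 + R) * ∫ ξ in t..τ, c ξ) * ∫ ξ in t..τ, lam ξ := by gcongr
  linarith

/-- (I4) -/
lemma euler {H : ℝ → PathSp n h T → Euc n → ℝ} {c : ℝ → ℝ} (hS : Sys H c)
    {t τ : ℝ} (ht : 0 ≤ t) (htτ : t ≤ τ) (hτ : τ ≤ T) (x : PathSp n h T) (s s' : Euc n) {η : ℝ} (hη : 0 < η) :
    ∃ y ∈ Ad c t x, II H t τ y s - II H t τ y s' ≤ inner ℝ (s - s') (evalP y τ - evalP y t) + η := by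
  obtain ⟨D, hD, hSD⟩ := Reach_compact hS.hc (isCompact_singleton (x := x))
  obtain ⟨R, hR0, hR⟩ := Reach_bdd hS.hc (isCompact_singleton (x := x))
  obtain ⟨lam, hl, hlip⟩ := hS.lip D hD
  set S := Reach c {x} with hSdef
  have hSi : ∀ x ∈ S, ∀ t ∈ Icc (0:ℝ) T, ∀ y ∈ Ad c t x, y ∈ S := fun x hx t ht y hy => Reach_inv hS.hc hx ht hy
  set L := ∫ ξ in (0:ℝ)..T, lam ξ with hL
  have hL0 : 0 ≤ L := int_nonneg hl le_rfl hT.out.le le_rfl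
  set C := (2 + ‖s‖ + ‖s'‖) * (1 + R) with hC
  have hC0 : 0 < C := by positivity
  set δ := η / (C * (L + 1)) with hδ
  have hδ0 : 0 < δ := by positivity
  obtain ⟨ρ, hρ, hρc⟩ := unif_int hT.out.le hS.hc.1 hδ0
  obtain ⟨N, hN⟩ := exists_nat_ge ((τ - t) / ρ)
  rw [div_le_iff₀ hρ] at hN
  set p : ℕ → ℝ := fun i => min (t + i * ρ) τ with hp
  have hpm : Monotone p := fun i j hij => by
    simp only [hp]
    have : (i:ℝ) ≤ j := by exact_mod_cast hij
    gcongr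
  have hp0 : p 0 = t := by simp [hp, htτ]
  have hpN : p N = τ := by
    simp only [hp]; exact min_eq_right (by linarith)
  have hpt : ∀ i, t ≤ p i := fun i => by rw [← hp0]; exact hpm (Nat.zero_le i)
  have hpI : ∀ i, p i ∈ Icc 0 T := fun i => ⟨ht.trans (hpt i), (min_le_right _ _).trans hτ⟩
  have hps : ∀ i, p (i+1) - p i ≤ ρ := by
    intro i
    simp only [hp]
    push_cast
    rcases le_total (t + i * ρ) τ with h1 | h1
    · rw [min_eq_left h1]; linarith [min_le_left (t + (i + 1) * ρ) τ]
    · rw [min_eq_right h1]; linarith [min_le_right (t + (i + 1) * ρ) τ]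
  obtain ⟨y, hy, hyQ⟩ := concat hS.hc hSi hpm hpI
    (Q := fun i y => II H (p i) (p (i+1)) y s - II H (p i) (p (i+1)) y s' ≤
      inner ℝ (s - s') (evalP y (p (i+1)) - evalP y (p i)) + C * δ * ∫ ξ in (p i)..(p (i+1)), lam ξ)
    (by
      intro i y z hyz hq
      rw [← II_congr hS (hpI i).1 (hpm (Nat.le_succ i)) (hpI (i+1)).2 hyz,
        ← II_congr hS (hpI i).1 (hpm (Nat.le_succ i)) (hpI (i+1)).2 hyz,
        ← stop_eval (hpI (i+1)).1 le_rfl hyz, ← stop_eval (hpI (i+1)).1 (hpm (Nat.le_succ i)) hyz]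
      exact hq) N
    (by
      intro i _ x hx
      have hpi := hpm (Nat.le_succ i)
      obtain ⟨y, hy, hyi⟩ := euler_step hS hSi hSD hl hlip hR0 hR (hpI i).1 hpi (hpI (i+1)).2 hx s s'
      refine ⟨y, hy, hyi.trans ?_⟩
      have e1 := (le_abs_self _).trans (hρc _ _ (hpI i).1 hpi (hpI (i+1)).2 (hps i))
      have e2 := int_nonneg hl (hpI i).1 hpi (hpI (i+1)).2
      have e3 : (2 + ‖s‖ + ‖s'‖) * ((1 + R) * ∫ ξ in (p i)..(p (i+1)), c ξ) ≤ C * δ := by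
        rw [hC, mul_assoc]; gcongr
      gcongr)
    x (Reach_self hS.hc rfl)
  rw [hp0] at hy
  have key : ∀ j ≤ N, II H t (p j) y s - II H t (p j) y s' ≤
      inner ℝ (s - s') (evalP y (p j) - evalP y t) + C * δ * ∫ ξ in t..(p j), lam ξ := by
    intro j hj
    induction j with
    | zero => rw [hp0]; simp [II]
    | succ j ih =>
      have i1 := ih (by omega)
      have i2 := hyQ j (by omega)
      rw [← II_add hS ht (hpt j) (hpm (Nat.le_succ j)) (hpI _).2, ← II_add hS ht (hpt j) (hpm (Nat.le_succ j)) (hpI _).2,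
        ← int_split hl ht (hpt j) (hpm (Nat.le_succ j)) (hpI _).2]
      have : evalP y (p (j+1)) - evalP y t = (evalP y (p (j+1)) - evalP y (p j)) + (evalP y (p j) - evalP y t) := by abel
      rw [this, inner_add_right, mul_add]
      linarith
  have := key N le_rfl
  rw [hpN] at this
  refine ⟨y, hy, this.trans ?_⟩
  have e1 : ∫ ξ in t..τ, lam ξ ≤ L := int_mono hl le_rfl ht htτ hτ le_rfl
  have e2 : C * δ * ∫ ξ in t..τ, lam ξ ≤ C * δ * L := by gcongr
  have e3 : C * δ * L ≤ η := by
    rw [hδ]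
    have : C * (η / (C * (L + 1))) * L = η * (L / (L + 1)) := by field_simp
    rw [this]
    have : L / (L + 1) ≤ 1 := by rw [div_le_one (by positivity)]; linarith
    nlinarith
  linarith

/-- bounded on compact sets -/
def BC (ψ : PathSp n h T → ℝ) : Prop := ∀ D : Set (PathSp n h T), IsCompact D → ∃ B : ℝ, ∀ y ∈ D, |ψ y| ≤ B

/-- step functional -/
def FF (H : ℝ → PathSp n h T → Euc n → ℝ) (t τ : ℝ) (ψ : PathSp n h T → ℝ) (s : Euc n) (y : PathSp n h T) : ℝ :=
  ψ y - inner ℝ s (evalP y τ - evalP y t) + II H t τ y s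

/-- one-step operator -/
def stepOp (H : ℝ → PathSp n h T → Euc n → ℝ) (c : ℝ → ℝ) (t τ : ℝ) (ψ : PathSp n h T → ℝ) (x : PathSp n h T) : ℝ :=
  ⨆ s : Euc n, sInf (FF H t τ ψ s '' Ad c t x)

lemma stepOp_spec {H : ℝ → PathSp n h T → Euc n → ℝ} {c : ℝ → ℝ} (hS : Sys H c)
    {t τ : ℝ} (ht : 0 ≤ t) (htτ : t ≤ τ) (hτ : τ ≤ T) {ψ : PathSp n h T → ℝ} (hψ : BC ψ) :
    BC (stepOp H c t τ ψ) ∧ (∀ x x', stopPath t x = stopPath t x' → stepOp H c t τ ψ x = stepOp H c t τ ψ x') ∧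
    (∀ x s η, 0 < η → ∃ y ∈ Ad c t x, FF H t τ ψ s y ≤ stepOp H c t τ ψ x + η) ∧
    (∀ x s η, 0 < η → ∃ y ∈ Ad c t x, stepOp H c t τ ψ x - η ≤ FF H t τ ψ s y) := by
  have htI : t ∈ Icc 0 T := ⟨ht, htτ.trans hτ⟩
  -- main bounds
  have main : ∀ D₀ : Set (PathSp n h T), IsCompact D₀ → ∃ B : ℝ, 0 ≤ B ∧ ∃ K : ℝ, ∀ x ∈ D₀, ∀ y ∈ Ad c t x,
      |FF H t τ ψ 0 y| ≤ B ∧ ∀ s, -(B + K * ‖s‖) ≤ FF H t τ ψ s y := by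
    intro D₀ hD₀
    obtain ⟨D, hD, hSD⟩ := Reach_compact hS.hc hD₀
    obtain ⟨R, hR0, hR⟩ := Reach_bdd hS.hc hD₀
    obtain ⟨m, hm, hmb⟩ := hS.bdd D hD
    obtain ⟨B, hB⟩ := hψ D hD
    refine ⟨|B| + ∫ ξ in t..τ, m ξ, add_nonneg (abs_nonneg _) (int_nonneg hm ht htτ hτ),
      2 * ((1 + R) * ∫ ξ in t..τ, c ξ), fun x hx y hy => ?_⟩
    have hyS : y ∈ Reach c D₀ := ⟨t, htI, x, hx, hy⟩
    have a1 := (hB y (hSD hyS)).trans (le_abs_self B)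
    have a2 := II_zero hm hmb ht htτ hτ (hSD hyS)
    have a0 : |FF H t τ ψ 0 y| ≤ |B| + ∫ ξ in t..τ, m ξ := by
      unfold FF
      rw [inner_zero_left, sub_zero]
      exact (abs_add_le _ _).trans (by linarith)
    refine ⟨a0, fun s => ?_⟩
    have a3 := II_s hS ht htτ hτ (hR y hyS) s 0
    rw [sub_zero] at a3
    have a4 : |inner ℝ s (evalP y τ - evalP y t)| ≤ ‖s‖ * ((1 + R) * ∫ ξ in t..τ, c ξ) := by
      refine (abs_real_inner_le_norm _ _).trans ?_
      have := Ad_incr hS.hc ht hy (hR y hyS) le_rfl htτ hτ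
      gcongr
    have a5 : FF H t τ ψ s y = FF H t τ ψ 0 y - inner ℝ s (evalP y τ - evalP y t) + (II H t τ y s - II H t τ y 0) := by
      unfold FF; rw [inner_zero_left]; ring
    rw [a5]
    have := (abs_le.1 a0).1
    have := (abs_le.1 a3).1
    have := (abs_le.1 a4).2
    linarith
  have eul : ∀ x s s' η, 0 < η → ∃ y ∈ Ad c t x, FF H t τ ψ s y ≤ FF H t τ ψ s' y + η := by
    intro x s s' η hη
    obtain ⟨y, hy, h1⟩ := euler hS ht htτ hτ x s s' hη
    refine ⟨y, hy, ?_⟩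
    unfold FF
    rw [inner_sub_left] at h1
    linarith
  have hne : ∀ x : PathSp n h T, (Ad c t x).Nonempty := fun x => ⟨_, Ad_self hS.hc ht x⟩
  have hbb : ∀ x s, BddBelow (FF H t τ ψ s '' Ad c t x) := by
    intro x s
    obtain ⟨B, hB0, K, hB⟩ := main {x} isCompact_singleton
    refine ⟨-(B + K * ‖s‖), ?_⟩
    rintro _ ⟨y, hy, rfl⟩
    exact (hB x rfl y hy).2 s
  have hJ : ∀ x B, (∀ y ∈ Ad c t x, |FF H t τ ψ 0 y| ≤ B) → ∀ s, sInf (FF H t τ ψ s '' Ad c t x) ≤ B := by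
    intro x B hB s
    refine le_of_forall_pos_le_add fun η hη => ?_
    obtain ⟨y, hy, h1⟩ := eul x s 0 η hη
    have h2 := csInf_le (hbb x s) (mem_image_of_mem _ hy)
    have h3 := (abs_le.1 (hB y hy)).2
    linarith
  have hbA : ∀ x, BddAbove (range fun s : Euc n => sInf (FF H t τ ψ s '' Ad c t x)) := by
    intro x
    obtain ⟨B, hB0, K, hB⟩ := main {x} isCompact_singleton
    refine ⟨B, ?_⟩
    rintro _ ⟨s, rfl⟩
    exact hJ x B (fun y hy => (hB x rfl y hy).1) s
  refine ⟨?_, ?_, ?_, ?_⟩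
  · intro D₀ hD₀
    obtain ⟨B, hB0, K, hB⟩ := main D₀ hD₀
    refine ⟨B, fun x hx => abs_le.2 ⟨?_, ?_⟩⟩
    · refine le_trans ?_ (le_ciSup (hbA x) 0)
      refine le_csInf ((hne x).image _) ?_
      rintro _ ⟨y, hy, rfl⟩
      exact (abs_le.1 (hB x hx y hy).1).1
    · exact ciSup_le fun s => hJ x B (fun y hy => (hB x hx y hy).1) s
  · intro x x' hxx
    unfold stepOp
    rw [Ad_congr hxx]
  · intro x s η hη
    obtain ⟨_, ⟨y, hy, rfl⟩, h1⟩ := exists_lt_of_csInf_lt ((hne x).image _)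
      (lt_add_of_pos_right (sInf (FF H t τ ψ s '' Ad c t x)) hη)
    exact ⟨y, hy, h1.le.trans (add_le_add_left (le_ciSup (hbA x) s) _)⟩
  · intro x s' η hη
    obtain ⟨s, hs⟩ := exists_lt_of_lt_ciSup (sub_lt_self (stepOp H c t τ ψ x) (half_pos hη))
    obtain ⟨y, hy, h1⟩ := eul x s s' (η/2) (half_pos hη)
    refine ⟨y, hy, ?_⟩
    have h2 := csInf_le (hbb x s) (mem_image_of_mem _ hy)
    linarith

end EulerSec


section ApprSec

variable {n : ℕ} {h T : ℝ} [hT : Fact (0 < T)] [hh : Fact (0 ≤ h)]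

/-- a family of discrete-time approximations -/
structure Appr (H : ℝ → PathSp n h T → Euc n → ℝ) (c : ℝ → ℝ) (σ : PathSp n h T → ℝ) (N : ℕ) (g : ℕ → ℝ)
    (Φ : ℕ → PathSp n h T → ℝ) : Prop where
  mono : Monotone g
  gI : ∀ i, g i ∈ Icc (0:ℝ) T
  g0 : g 0 = 0
  gN : g N = T
  last : Φ N = σ
  na : ∀ i ≤ N, ∀ x x', stopPath (g i) x = stopPath (g i) x' → Φ i x = Φ i x'
  U : ∀ i < N, ∀ x s η, 0 < η → ∃ y ∈ Ad c (g i) x, FF H (g i) (g (i+1)) (Φ (i+1)) s y ≤ Φ i x + η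
  L : ∀ i < N, ∀ x s η, 0 < η → ∃ y ∈ Ad c (g i) x, Φ i x - η ≤ FF H (g i) (g (i+1)) (Φ (i+1)) s y

lemma FF_neg (H : ℝ → PathSp n h T → Euc n → ℝ) (a b : ℝ) (ψ : PathSp n h T → ℝ) (s : Euc n) (y : PathSp n h T) :
    FF (negH H) a b (fun x => - ψ x) s y = - FF H a b ψ (-s) y := by
  unfold FF
  rw [II_neg, inner_neg_left]; ring

lemma Appr.neg {H : ℝ → PathSp n h T → Euc n → ℝ} {c : ℝ → ℝ} {σ : PathSp n h T → ℝ} {N : ℕ} {g : ℕ → ℝ}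
    {Φ : ℕ → PathSp n h T → ℝ} (hA : Appr H c σ N g Φ) :
    Appr (negH H) c (fun x => - σ x) N g (fun i x => - Φ i x) := by
  refine ⟨hA.mono, hA.gI, hA.g0, hA.gN, by simp [hA.last], fun i hi x x' hx => by rw [hA.na i hi x x' hx], ?_, ?_⟩
  · intro i hi x s η hη
    obtain ⟨y, hy, h1⟩ := hA.L i hi x (-s) η hη
    refine ⟨y, hy, ?_⟩
    rw [FF_neg]; linarith
  · intro i hi x s η hη
    obtain ⟨y, hy, h1⟩ := hA.U i hi x (-s) η hη
    refine ⟨y, hy, ?_⟩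
    rw [FF_neg]; linarith

/-- backward recursion -/
def backRec (H : ℝ → PathSp n h T → Euc n → ℝ) (c : ℝ → ℝ) (σ : PathSp n h T → ℝ) (N : ℕ) (g : ℕ → ℝ) :
    ℕ → PathSp n h T → ℝ
  | 0 => σ
  | j + 1 => stepOp H c (g (N - (j + 1))) (g (N - j)) (backRec H c σ N g j)

lemma Appr_exists {H : ℝ → PathSp n h T → Euc n → ℝ} {c : ℝ → ℝ} (hS : Sys H c) {σ : PathSp n h T → ℝ}
    (hσ : Continuous σ) {N : ℕ} {g : ℕ → ℝ} (mono : Monotone g)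
    (gI : ∀ i, g i ∈ Icc (0:ℝ) T) (g0 : g 0 = 0) (gN : g N = T) : ∃ Φ, Appr H c σ N g Φ := by
  have hBC : ∀ j, BC (backRec H c σ N g j) := by
    intro j
    induction j with
    | zero =>
      intro D hD
      obtain ⟨B, hB⟩ := (hD.image hσ).isBounded.exists_norm_le
      exact ⟨B, fun y hy => hB _ (mem_image_of_mem _ hy)⟩
    | succ j ih => exact (stepOp_spec hS (gI _).1 (mono (by omega)) (gI _).2 ih).1
  have hstep : ∀ i < N, backRec H c σ N g (N - i) =
      stepOp H c (g i) (g (i+1)) (backRec H c σ N g (N - (i+1))) := by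
    intro i hi
    obtain ⟨j, hj⟩ : ∃ j, N = i + 1 + j := ⟨N - (i+1), by omega⟩
    have e1 : N - i = j + 1 := by omega
    have e2 : N - (i + 1) = j := by omega
    have e3 : N - (j + 1) = i := by omega
    have e4 : N - j = i + 1 := by omega
    rw [e1, e2]
    show stepOp H c (g (N - (j + 1))) (g (N - j)) _ = _
    rw [e3, e4]
  refine ⟨fun i => backRec H c σ N g (N - i), mono, gI, g0, gN, ?_, ?_, ?_, ?_⟩
  · show backRec H c σ N g (N - N) = σ
    rw [Nat.sub_self]; rfl
  · intro i hi x x' hx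
    rcases hi.lt_or_eq with h1 | h1
    · show backRec H c σ N g (N - i) x = backRec H c σ N g (N - i) x'
      rw [hstep i h1]
      exact (stepOp_spec hS (gI _).1 (mono (Nat.le_succ i)) (gI _).2 (hBC _)).2.1 x x' hx
    · subst h1
      rw [gN, stop_T, stop_T] at hx
      rw [hx]
  · intro i hi x s η hη
    have := (stepOp_spec hS (gI _).1 (mono (Nat.le_succ i)) (gI _).2 (hBC (N - (i+1)))).2.2.1 x s η hη
    rw [← hstep i hi] at this
    exact this
  · intro i hi x s η hη
    have := (stepOp_spec hS (gI _).1 (mono (Nat.le_succ i)) (gI _).2 (hBC (N - (i+1)))).2.2.2 x s η hη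
    rw [← hstep i hi] at this
    exact this

lemma Appr.multiU {H : ℝ → PathSp n h T → Euc n → ℝ} {c : ℝ → ℝ} (hS : Sys H c) {σ : PathSp n h T → ℝ} {N : ℕ}
    {g : ℕ → ℝ} {Φ : ℕ → PathSp n h T → ℝ} (hA : Appr H c σ N g Φ) {i j : ℕ} (hij : i ≤ j) (hj : j ≤ N)
    (x : PathSp n h T) (s : Euc n) {η : ℝ} (hη : 0 < η) :
    ∃ y ∈ Ad c (g i) x, FF H (g i) (g j) (Φ j) s y ≤ Φ i x + η := by
  induction j, hij using Nat.le_induction generalizing η with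
  | base =>
    refine ⟨_, Ad_self hS.hc (hA.gI i).1 x, ?_⟩
    unfold FF II
    rw [hA.na i hj _ x (by rw [stop_stop (hA.gI i).1 (hA.gI i).1, min_self])]
    simp [hη.le]
  | succ j hij ih =>
    obtain ⟨y, hy, h1⟩ := ih (by omega) (half_pos hη)
    obtain ⟨z, hz, h2⟩ := hA.U j (by omega) y s (η/2) (half_pos hη)
    refine ⟨z, Ad_concat hS.hc (hA.gI i).1 (hA.mono hij) hy hz, ?_⟩
    unfold FF at h1 h2 ⊢
    rw [← II_add hS (hA.gI i).1 (hA.mono hij) (hA.mono (Nat.le_succ j)) (hA.gI _).2,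
      II_congr hS (hA.gI i).1 (hA.mono hij) (hA.gI j).2 hz.1]
    have e1 : evalP z (g (j+1)) - evalP z (g i) =
        (evalP z (g (j+1)) - evalP z (g j)) + (evalP y (g j) - evalP y (g i)) := by
      rw [← stop_eval (hA.gI j).1 le_rfl hz.1, ← stop_eval (hA.gI j).1 (hA.mono hij) hz.1]; abel
    rw [e1, inner_add_right]
    linarith

lemma Appr.multiL {H : ℝ → PathSp n h T → Euc n → ℝ} {c : ℝ → ℝ} (hS : Sys H c) {σ : PathSp n h T → ℝ} {N : ℕ}
    {g : ℕ → ℝ} {Φ : ℕ → PathSp n h T → ℝ} (hA : Appr H c σ N g Φ) {i j : ℕ} (hij : i ≤ j) (hj : j ≤ N)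
    (x : PathSp n h T) (s : Euc n) {η : ℝ} (hη : 0 < η) :
    ∃ y ∈ Ad c (g i) x, Φ i x - η ≤ FF H (g i) (g j) (Φ j) s y := by
  obtain ⟨y, hy, h1⟩ := hA.neg.multiU hS.neg hij hj x (-s) hη
  refine ⟨y, hy, ?_⟩
  rw [FF_neg, neg_neg] at h1
  linarith

/-- (E1) uniform bound -/
lemma Appr_bound {H : ℝ → PathSp n h T → Euc n → ℝ} {c : ℝ → ℝ} (hS : Sys H c) {σ : PathSp n h T → ℝ}
    (hσ : Continuous σ) {D₀ : Set (PathSp n h T)} (hD₀ : IsCompact D₀) :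
    ∃ B : ℝ, ∀ N g Φ, Appr H c σ N g Φ → ∀ i ≤ N, ∀ x ∈ Reach c D₀, |Φ i x| ≤ B := by
  obtain ⟨D, hD, hSD⟩ := Reach_compact hS.hc hD₀
  obtain ⟨m, hm, hmb⟩ := hS.bdd D hD
  obtain ⟨B, hB⟩ := (hD.image hσ).isBounded.exists_norm_le
  refine ⟨B + ∫ ξ in (0:ℝ)..T, m ξ, fun N g Φ hA i hi x hx => ?_⟩
  have hb : ∀ y ∈ Ad c (g i) x, |FF H (g i) (g N) (Φ N) 0 y| ≤ B + ∫ ξ in (0:ℝ)..T, m ξ := by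
    intro y hy
    have hyS := hSD (Reach_inv hS.hc hx (hA.gI i) hy)
    unfold FF
    rw [inner_zero_left, sub_zero, hA.last]
    refine (abs_add_le _ _).trans (add_le_add (hB _ (mem_image_of_mem _ hyS)) ?_)
    refine (II_zero hm hmb (hA.gI i).1 (hA.mono hi) (hA.gI N).2 hyS).trans ?_
    exact int_mono hm le_rfl (hA.gI i).1 (hA.mono hi) (hA.gI N).2 le_rfl
  refine abs_le.2 ⟨?_, ?_⟩
  · refine le_of_forall_pos_le_add fun η hη => ?_
    obtain ⟨y, hy, h1⟩ := hA.multiU hS hi le_rfl x 0 hη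
    linarith [(abs_le.1 (hb y hy)).1]
  · refine le_of_forall_pos_le_add fun η hη => ?_
    obtain ⟨y, hy, h1⟩ := hA.multiL hS hi le_rfl x 0 hη
    linarith [(abs_le.1 (hb y hy)).2]

/-- the Lyapunov-type polynomial -/
def ups (m r : ℝ) : ℝ := m ^ 2 - 2 * m * r + 2 * r ^ 2

lemma ups_lower (m r : ℝ) : m ^ 2 / 2 ≤ ups m r := by
  unfold ups; nlinarith [sq_nonneg (m - 2 * r)]

lemma ups_upper {m r : ℝ} (h0 : 0 ≤ r) (hr : r ≤ m) : ups m r ≤ m ^ 2 := by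
  unfold ups; nlinarith

lemma ups_incr {p p' : Euc n} {M M' Q a : ℝ} (hM : 0 ≤ M) (hp : ‖p‖ ≤ M) (hp' : ‖p'‖ ≤ M') (hMM : M ≤ M')
    (hMa : M' ≤ M + a) (hQ : M' ≤ Q) (ha : 0 ≤ a) (hpp : ‖p' - p‖ ≤ a) (hmax : M' ≤ M ∨ M' ≤ ‖p'‖ + a) :
    ups (M' ^ 2) (‖p'‖ ^ 2) ≤ ups (M ^ 2) (‖p‖ ^ 2) + inner ℝ ((8 * ‖p‖ ^ 2 - 4 * M ^ 2) • p) (p' - p)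
      + 18 * Q ^ 2 * a ^ 2 := by
  have hQ0 : 0 ≤ Q := by linarith
  set r := ‖p‖ ^ 2 with hr
  set r' := ‖p'‖ ^ 2 with hr'
  set m := M ^ 2 with hm
  set m' := M' ^ 2 with hm'
  have e1 : r' - r = 2 * inner ℝ p (p' - p) + ‖p' - p‖ ^ 2 := by
    have : p' = p + (p' - p) := by abel
    have h2 := norm_add_sq_real p (p' - p)
    rw [← this] at h2
    rw [hr', hr, h2]; ring
  have n0 := norm_nonneg p
  have n0' := norm_nonneg p'
  have nd : ‖p' - p‖ ^ 2 ≤ a ^ 2 := pow_le_pow_left₀ (norm_nonneg _) hpp 2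
  have rm : r ≤ m := pow_le_pow_left₀ n0 hp 2
  have rm' : r' ≤ m' := pow_le_pow_left₀ n0' hp' 2
  have mm : m ≤ m' := pow_le_pow_left₀ hM hMM 2
  have mQ : m' ≤ Q ^ 2 := pow_le_pow_left₀ (hM.trans hMM) hQ 2
  have r0 : 0 ≤ r := sq_nonneg _
  -- first difference
  have d1 : (m' - m) * (m' + m - 2 * r') ≤ 8 * Q ^ 2 * a ^ 2 := by
    rcases hmax with h1 | h1
    · have : M' = M := le_antisymm h1 hMM
      have : m' - m = 0 := by rw [hm', hm, this]; ring
      rw [this, zero_mul]; positivity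
    · have f1 : m' - m ≤ 2 * Q * a := by
        have : m' - m = (M' - M) * (M' + M) := by rw [hm', hm]; ring
        rw [this]
        calc (M' - M) * (M' + M) ≤ a * (Q + Q) := by
              apply mul_le_mul <;> linarith
          _ = _ := by ring
      have f2 : m' - r' ≤ 2 * Q * a := by
        have : m' - r' = (M' - ‖p'‖) * (M' + ‖p'‖) := by rw [hm', hr']; ring
        rw [this]
        calc (M' - ‖p'‖) * (M' + ‖p'‖) ≤ a * (Q + Q) := by
              apply mul_le_mul <;> linarith
          _ = _ := by ring
      have f3 : m' + m - 2 * r' ≤ 4 * Q * a := by linarith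
      have f0 : 0 ≤ 2 * Q * a := by positivity
      calc (m' - m) * (m' + m - 2 * r') ≤ (m' - m) * (4 * Q * a) :=
            mul_le_mul_of_nonneg_left f3 (by linarith)
        _ ≤ (2 * Q * a) * (4 * Q * a) := mul_le_mul_of_nonneg_right f1 (by linarith)
        _ = _ := by ring
  have d2 : (r' - r) ^ 2 ≤ 4 * Q ^ 2 * a ^ 2 := by
    have h1 : |‖p'‖ - ‖p‖| ≤ a := (abs_norm_sub_norm_le _ _).trans hpp
    have h2 : |r' - r| ≤ 2 * Q * a := by
      have : r' - r = (‖p'‖ - ‖p‖) * (‖p'‖ + ‖p‖) := by rw [hr', hr]; ring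
      rw [this, abs_mul]
      have h3 : |‖p'‖ + ‖p‖| ≤ Q + Q := by
        rw [abs_of_nonneg (by linarith)]; linarith
      calc _ ≤ a * (Q + Q) := mul_le_mul h1 h3 (abs_nonneg _) ha
        _ = _ := by ring
    calc (r' - r) ^ 2 = |r' - r| ^ 2 := (sq_abs _).symm
      _ ≤ (2 * Q * a) ^ 2 := pow_le_pow_left₀ (abs_nonneg _) h2 2
      _ = _ := by ring
  have d3 : (4 * r - 2 * m) * ‖p' - p‖ ^ 2 ≤ 2 * Q ^ 2 * a ^ 2 := by
    calc (4 * r - 2 * m) * ‖p' - p‖ ^ 2 ≤ (2 * Q ^ 2) * ‖p' - p‖ ^ 2 :=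
          mul_le_mul_of_nonneg_right (by linarith) (sq_nonneg _)
      _ ≤ _ := mul_le_mul_of_nonneg_left nd (by positivity)
  rw [inner_smul_left]
  simp only [conj_trivial]
  have : ups m' r' = ups m r + (m' - m) * (m' + m - 2 * r') + (4 * r - 2 * m) * (r' - r) + 2 * (r' - r) ^ 2 := by
    unfold ups; ring
  rw [this]
  have : (4 * r - 2 * m) * (r' - r) = (8 * r - 4 * m) * inner ℝ p (p' - p) + (4 * r - 2 * m) * ‖p' - p‖ ^ 2 := by
    rw [e1]; ring
  rw [this]
  linarith

set_option maxHeartbeats 1000000 in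
/-- the full one-step inequality -/
lemma nu_step {p p' : Euc n} {M M' Q a l α α' A ε : ℝ} (hM : 0 ≤ M) (hp : ‖p‖ ≤ M) (hp' : ‖p'‖ ≤ M') (hMM : M ≤ M')
    (hMa : M' ≤ M + a) (hQ : M' ≤ Q) (ha : 0 ≤ a) (hpp : ‖p' - p‖ ≤ a) (hmax : M' ≤ M ∨ M' ≤ ‖p'‖ + a)
    (hl : 0 ≤ l) (hα : 1 ≤ α') (hαA : α' ≤ A) (hαα : α' * (1 + 10 * l) ≤ α) (hε : 0 < ε) :
    α' * (ε + ups (M' ^ 2) (‖p'‖ ^ 2) / ε ^ 3) - inner ℝ ((α' / ε ^ 3) • (8 * ‖p‖ ^ 2 - 4 * M ^ 2) • p) (p' - p)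
      + (1 + ‖(α' / ε ^ 3) • (8 * ‖p‖ ^ 2 - 4 * M ^ 2) • p‖) * M' * l
    ≤ α * (ε + ups (M ^ 2) (‖p‖ ^ 2) / ε ^ 3)
      + (18 * A * Q ^ 2 / ε ^ 3 + 1 + 4 * A * Q ^ 3 / ε ^ 3) * (a * (a + l)) := by
  have hu := ups_incr hM hp hp' hMM hMa hQ ha hpp hmax
  have hQ0 : 0 ≤ Q := by linarith
  have hMQ : M ≤ Q := by linarith
  have hA0 : 0 ≤ A := by linarith
  set q := (8 * ‖p‖ ^ 2 - 4 * M ^ 2) • p with hq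
  set Y := ups (M ^ 2) (‖p‖ ^ 2) with hY
  have e3 : 0 < ε ^ 3 := by positivity
  have hqn : ‖q‖ ≤ 4 * M ^ 3 := by
    rw [hq, norm_smul, Real.norm_eq_abs]
    have h1 : ‖p‖ ^ 2 ≤ M ^ 2 := pow_le_pow_left₀ (norm_nonneg _) hp 2
    have h2 : |8 * ‖p‖ ^ 2 - 4 * M ^ 2| ≤ 4 * M ^ 2 := abs_le.2 ⟨by nlinarith [sq_nonneg ‖p‖], by nlinarith⟩
    calc _ ≤ (4 * M ^ 2) * M := mul_le_mul h2 hp (norm_nonneg _) (by positivity)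
      _ = _ := by ring
  rw [inner_smul_left, norm_smul, Real.norm_eq_abs, abs_of_nonneg (by positivity : 0 ≤ α' / ε ^ 3)]
  simp only [conj_trivial]
  have hβ0 : 0 ≤ α' / ε ^ 3 := by positivity
  set β := α' / ε ^ 3 with hβ
  have hβA : β ≤ A / ε ^ 3 := by rw [hβ]; gcongr
  have e4 : α' * (ε + ups (M' ^ 2) (‖p'‖ ^ 2) / ε ^ 3) = α' * ε + β * ups (M' ^ 2) (‖p'‖ ^ 2) := by
    rw [hβ]; ring
  have e5 : β * ups (M' ^ 2) (‖p'‖ ^ 2) ≤ β * (Y + inner ℝ q (p' - p) + 18 * Q ^ 2 * a ^ 2) := by gcongr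
  have e6 : β * (18 * Q ^ 2 * a ^ 2) ≤ 18 * A * Q ^ 2 / ε ^ 3 * a ^ 2 := by
    calc _ ≤ (A / ε ^ 3) * (18 * Q ^ 2 * a ^ 2) := by gcongr
      _ = _ := by ring
  -- the norm term
  have f1 : (1 + β * ‖q‖) * M' ≤ (1 + 4 * β * M ^ 3) * M + (1 + 4 * A * Q ^ 3 / ε ^ 3) * a := by
    have g1 : β * ‖q‖ ≤ 4 * β * M ^ 3 := by
      calc _ ≤ β * (4 * M ^ 3) := by gcongr
        _ = _ := by ring
    have g2 : 4 * β * M ^ 3 ≤ 4 * A * Q ^ 3 / ε ^ 3 := by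
      calc _ ≤ 4 * (A / ε ^ 3) * Q ^ 3 := by gcongr
        _ = _ := by ring
    calc (1 + β * ‖q‖) * M' ≤ (1 + 4 * β * M ^ 3) * (M + a) := by
          apply mul_le_mul _ hMa (by linarith) (by positivity)
          linarith
      _ = (1 + 4 * β * M ^ 3) * M + (1 + 4 * β * M ^ 3) * a := by ring
      _ ≤ _ := by gcongr
  have f2 : (1 + 4 * β * M ^ 3) * M ≤ 10 * (α' * (ε + Y / ε ^ 3)) := by
    have g1 : M ^ 4 / 2 ≤ Y := by
      have := ups_lower (M ^ 2) (‖p‖ ^ 2)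
      calc M ^ 4 / 2 = (M ^ 2) ^ 2 / 2 := by ring
        _ ≤ _ := this
    have g2 : M ≤ ε + M ^ 4 / ε ^ 3 := by
      rcases le_total M ε with h1 | h1
      · have : 0 ≤ M ^ 4 / ε ^ 3 := by positivity
        linarith
      · have : M ≤ M ^ 4 / ε ^ 3 := by
          rw [le_div_iff₀ e3]
          calc M * ε ^ 3 ≤ M * M ^ 3 := by gcongr
            _ = _ := by ring
        linarith
    have g3 : M ≤ α' * ε + β * M ^ 4 := by
      have : α' * ε + β * M ^ 4 = α' * (ε + M ^ 4 / ε ^ 3) := by rw [hβ]; ring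
      rw [this]
      have : 0 ≤ ε + M ^ 4 / ε ^ 3 := by positivity
      nlinarith
    have g4 : β * (M ^ 4 / 2) ≤ β * Y := by gcongr
    have g5 : 10 * (α' * (ε + Y / ε ^ 3)) = 10 * (α' * ε) + 10 * (β * Y) := by rw [hβ]; ring
    rw [g5]
    have g6 : (1 + 4 * β * M ^ 3) * M = M + 4 * (β * M ^ 4) := by ring
    rw [g6]
    have : 0 ≤ α' * ε := by positivity
    nlinarith
  have f3 : (1 + β * ‖q‖) * M' * l ≤ (10 * (α' * (ε + Y / ε ^ 3)) + (1 + 4 * A * Q ^ 3 / ε ^ 3) * a) * l :=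
    mul_le_mul_of_nonneg_right (by linarith) hl
  have hY0 : 0 ≤ ε + Y / ε ^ 3 := by
    have := ups_lower (M ^ 2) (‖p‖ ^ 2)
    have : 0 ≤ Y := le_trans (by positivity) this
    positivity
  have f4 : α' * (1 + 10 * l) * (ε + Y / ε ^ 3) ≤ α * (ε + Y / ε ^ 3) := by gcongr
  have f5 : α' * ε + β * Y = α' * (ε + Y / ε ^ 3) := by rw [hβ]; ring
  have f6 : 0 ≤ 18 * A * Q ^ 2 / ε ^ 3 * (a * l) := by positivity
  have f7 : 0 ≤ (1 + 4 * A * Q ^ 3 / ε ^ 3) * (a * a) := by positivity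
  rw [e4]
  linarith

end ApprSec


section CompSec

variable {n : ℕ} {h T : ℝ} [hT : Fact (0 < T)] [hh : Fact (0 ≤ h)]

lemma compare_core {H : ℝ → PathSp n h T → Euc n → ℝ} {c : ℝ → ℝ} (hS : Sys H c) {σ : PathSp n h T → ℝ}
    {D₀ D : Set (PathSp n h T)} (hSD : Reach c D₀ ⊆ D) {lam : ℝ → ℝ} (hl : IntegNonneg T lam)
    (hlip : ∀ x₁ ∈ D, ∀ x₂ ∈ D, ∀ s : Euc n, ∀ᵐ t ∂(volume.restrict (Icc (0:ℝ) T)),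
      |H t x₁ s - H t x₂ s| ≤ lam t * (1 + ‖s‖) * ‖stopPath t x₁ - stopPath t x₂‖)
    {R : ℝ} (hR0 : 0 ≤ R) (hR : ∀ y ∈ Reach c D₀, ‖y‖ ≤ R) {ε κ A Q C δ : ℝ} (hε : 0 < ε)
    (hbase : ∀ y₁ ∈ Reach c D₀, ∀ y₂ ∈ Reach c D₀, σ y₁ - σ y₂ ≤ κ + ‖y₁ - y₂‖ ^ 4 / (2 * ε ^ 3))
    (hA : A = Real.exp (10 * ∫ ξ in (0:ℝ)..T, lam ξ)) (hQ : Q = 2 * R)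
    (hC : C = 18 * A * Q ^ 2 / ε ^ 3 + 1 + 4 * A * Q ^ 3 / ε ^ 3)
    {N : ℕ} {g : ℕ → ℝ} {Φ : ℕ → PathSp n h T → ℝ} (hAp : Appr H c σ N g Φ)
    (hmesh : ∀ i, 2 * ((1 + R) * ∫ ξ in (g i)..(g (i+1)), c ξ) ≤ δ) :
    ∀ j i, i + j = N → ∀ x₁ ∈ Reach c D₀, ∀ x₂ ∈ Reach c D₀, Φ i x₁ - Φ i x₂ ≤
      Real.exp (10 * ∫ ξ in (g i)..T, lam ξ) *
        (ε + ups (‖stopPath (g i) (x₁ - x₂)‖ ^ 2) (‖evalP (x₁ - x₂) (g i)‖ ^ 2) / ε ^ 3) + κ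
      + C * δ * (2 * ((1 + R) * ∫ ξ in (g i)..T, c ξ) + ∫ ξ in (g i)..T, lam ξ) := by
  have hA0 : 0 < A := by rw [hA]; positivity
  have hQ0 : 0 ≤ Q := by rw [hQ]; positivity
  have hC0 : 0 ≤ C := by rw [hC]; positivity
  intro j
  induction j with
  | zero =>
    intro i hi x₁ h1 x₂ h2
    simp only [add_zero] at hi
    subst hi
    rw [hAp.last, hAp.gN]
    simp only [intervalIntegral.integral_same, mul_zero, Real.exp_zero, one_mul, add_zero]
    refine (hbase x₁ h1 x₂ h2).trans ?_
    rw [stop_T]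
    have h3 := ups_lower (‖x₁ - x₂‖ ^ 2) (‖evalP (x₁ - x₂) T‖ ^ 2)
    have h4 : ‖x₁ - x₂‖ ^ 4 / (2 * ε ^ 3) = ((‖x₁ - x₂‖ ^ 2) ^ 2 / 2) / ε ^ 3 := by
      field_simp
    rw [h4]
    have h5 : ((‖x₁ - x₂‖ ^ 2) ^ 2 / 2) / ε ^ 3 ≤ ups (‖x₁ - x₂‖ ^ 2) (‖evalP (x₁ - x₂) T‖ ^ 2) / ε ^ 3 := by
      gcongr
    linarith
  | succ j ih =>
    intro i hi x₁ h1 x₂ h2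
    have ih' := ih (i+1) (by omega)
    have hiN : i < N := by omega
    have ht := (hAp.gI i)
    have ht' := (hAp.gI (i+1))
    have htt : g i ≤ g (i+1) := hAp.mono (Nat.le_succ i)
    have hmi := hmesh i
    set t := g i with htdef
    set t' := g (i+1) with htdef'
    set l := ∫ ξ in t..t', lam ξ with hldef
    set a := 2 * ((1 + R) * ∫ ξ in t..t', c ξ) with hadef
    have hl0 : 0 ≤ l := int_nonneg hl ht.1 htt ht'.2
    have hcc0 : 0 ≤ ∫ ξ in t..t', c ξ := int_nonneg hS.hc ht.1 htt ht'.2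
    have ha0 : 0 ≤ a := by positivity
    set α' := Real.exp (10 * ∫ ξ in t'..T, lam ξ) with hα'
    set w := x₁ - x₂ with hw
    set p := evalP w t with hp
    set M := ‖stopPath t w‖ with hM
    set s := (α' / ε ^ 3) • (8 * ‖p‖ ^ 2 - 4 * M ^ 2) • p with hs
    refine le_of_forall_pos_le_add fun η hη => ?_
    obtain ⟨y₁, hy₁, k1⟩ := hAp.L i hiN x₁ s (η/2) (half_pos hη)
    obtain ⟨y₂, hy₂, k2⟩ := hAp.U i hiN x₂ s (η/2) (half_pos hη)
    rw [← htdef] at hy₁ hy₂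
    have m1 := Reach_inv hS.hc h1 ht hy₁
    have m2 := Reach_inv hS.hc h2 ht hy₂
    have ihy := ih' y₁ m1 y₂ m2
    set w' := y₁ - y₂ with hw'
    have hst : stopPath t w' = stopPath t w := by
      rw [hw', hw, stopPath_sub, stopPath_sub, hy₁.1, hy₂.1]
    have hinc : ∀ u v, t ≤ u → u ≤ v → v ≤ t' → ‖evalP w' v - evalP w' u‖ ≤ a := by
      intro u v hu huv hv
      have i1 := Ad_incr hS.hc ht.1 hy₁ (hR y₁ m1) hu huv (hv.trans ht'.2)
      have i2 := Ad_incr hS.hc ht.1 hy₂ (hR y₂ m2) hu huv (hv.trans ht'.2)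
      have i3 : (1 + R) * ∫ ξ in u..v, c ξ ≤ (1 + R) * ∫ ξ in t..t', c ξ := by
        have := int_mono hS.hc ht.1 hu huv hv ht'.2
        gcongr
      have i4 : evalP w' v - evalP w' u = (evalP y₁ v - evalP y₁ u) - (evalP y₂ v - evalP y₂ u) := by
        rw [hw', evalP_sub, evalP_sub]; abel
      rw [i4]
      refine (norm_sub_le _ _).trans ?_
      rw [hadef]; linarith
    have hpw : p = evalP w' t := (stop_eval ht.1 le_rfl hst).symm
    set p' := evalP w' t' with hp'
    set M' := ‖stopPath t' w'‖ with hM'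
    have hM0 : 0 ≤ M := norm_nonneg _
    have q1 : ‖p‖ ≤ M := norm_eval_le_stop ht.1 le_rfl w
    have q2 : ‖p'‖ ≤ M' := norm_eval_le_stop ht'.1 le_rfl w'
    have q3 : M ≤ M' := by rw [hM, ← hst]; exact norm_stop_mono ht.1 htt w'
    have q4 : M' ≤ M + a := by
      have e1 := stop_incr ht.1 htt ha0 fun τ b1 b2 => hinc t τ le_rfl b1 b2
      have e2 : ‖stopPath t' w'‖ ≤ ‖stopPath t w'‖ + ‖stopPath t' w' - stopPath t w'‖ := by
        simpa using norm_add_le (stopPath t w') (stopPath t' w' - stopPath t w')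
      rw [hst] at e2 e1
      linarith
    have q5 : M' ≤ Q := by
      rw [hQ]
      have e1 := norm_stop_le t' w'
      have e2 := norm_sub_le y₁ y₂
      have e3 := hR y₁ m1
      have e4 := hR y₂ m2
      linarith
    have q6 : ‖p' - p‖ ≤ a := by rw [hpw]; exact hinc t t' le_rfl htt le_rfl
    have q7 : M' ≤ M ∨ M' ≤ ‖p'‖ + a := by
      rw [← le_max_iff]
      refine stop_norm_le ht'.1 (hM0.trans (le_max_left _ _)) fun τ b1 b2 => ?_
      rcases le_total τ t with b3 | b3
      · refine le_trans ?_ (le_max_left _ _)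
        rw [hM, ← hst]; exact norm_eval_le_stop ht.1 b3 w'
      · refine le_trans ?_ (le_max_right _ _)
        have e1 := hinc τ t' b3 b2 le_rfl
        rw [norm_sub_rev] at e1
        have e2 : ‖evalP w' τ‖ ≤ ‖evalP w' t'‖ + ‖evalP w' τ - evalP w' t'‖ := by
          simpa using norm_add_le (evalP w' t') (evalP w' τ - evalP w' t')
        linarith
    have hlT : (∫ ξ in t..T, lam ξ) = l + ∫ ξ in t'..T, lam ξ := (int_split hl ht.1 htt ht'.2 le_rfl).symm
    have hcT' : (∫ ξ in t..T, c ξ) = (∫ ξ in t..t', c ξ) + ∫ ξ in t'..T, c ξ :=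
      (int_split hS.hc ht.1 htt ht'.2 le_rfl).symm
    have hlT0 := int_nonneg hl ht'.1 ht'.2 le_rfl
    have hα1 : 1 ≤ α' := Real.one_le_exp (by positivity)
    have hαA : α' ≤ A := by
      rw [hA, hα']
      refine Real.exp_le_exp.2 ?_
      have := int_mono hl le_rfl ht'.1 ht'.2 (le_refl T) le_rfl
      linarith
    have hαα : α' * (1 + 10 * l) ≤ Real.exp (10 * ∫ ξ in t..T, lam ξ) := by
      rw [hlT, show (10:ℝ) * (l + ∫ ξ in t'..T, lam ξ) = 10 * (∫ ξ in t'..T, lam ξ) + 10 * l by ring, Real.exp_add]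
      have := Real.add_one_le_exp (10 * l)
      refine mul_le_mul_of_nonneg_left (by linarith) (by positivity)
    have hnu := nu_step hM0 q1 q2 q3 q4 q5 ha0 q6 q7 hl0 hα1 hαA hαα hε
    rw [← hs, ← hC] at hnu
    have hII := (abs_le.1 (II_lip hS hl hlip ht.1 htt ht'.2 (hSD m1) (hSD m2) s)).2
    rw [← hw', ← hM', ← hldef] at hII
    unfold FF at k1 k2
    have hin : inner ℝ s (evalP y₁ t' - evalP y₁ t) - inner ℝ s (evalP y₂ t' - evalP y₂ t) = inner ℝ s (p' - p) := by
      rw [← inner_sub_right, hpw, hp', hw', evalP_sub, evalP_sub]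
      congr 1; abel
    have herr : C * (a * (a + l)) ≤ C * δ * (a + l) := by
      have : a * (a + l) ≤ δ * (a + l) := mul_le_mul_of_nonneg_right hmi (by positivity)
      calc C * (a * (a + l)) ≤ C * (δ * (a + l)) := mul_le_mul_of_nonneg_left this (by first | assumption | positivity)
        _ = C * δ * (a + l) := by ring
    have hfin : 2 * ((1 + R) * ∫ ξ in t..T, c ξ) + ∫ ξ in t..T, lam ξ =
        (a + l) + (2 * ((1 + R) * ∫ ξ in t'..T, c ξ) + ∫ ξ in t'..T, lam ξ) := by
      rw [hlT, hcT', hadef]; ring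
    rw [hfin, mul_add]
    linarith

/-- (E2) -/
lemma Appr_equi {H : ℝ → PathSp n h T → Euc n → ℝ} {c : ℝ → ℝ} (hS : Sys H c) {σ : PathSp n h T → ℝ}
    (hσ : Continuous σ) {D₀ : Set (PathSp n h T)} (hD₀ : IsCompact D₀) {κ : ℝ} (hκ : 0 < κ) :
    ∃ ρ > 0, ∃ ρ' > 0, ∀ N g Φ, Appr H c σ N g Φ → (∀ i, g (i+1) - g i ≤ ρ') → ∀ i ≤ N,
      ∀ x₁ ∈ Reach c D₀, ∀ x₂ ∈ Reach c D₀, ‖stopPath (g i) (x₁ - x₂)‖ ≤ ρ → |Φ i x₁ - Φ i x₂| ≤ κ := by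
  obtain ⟨D, hD, hSD⟩ := Reach_compact hS.hc hD₀
  obtain ⟨R, hR0, hR⟩ := Reach_bdd hS.hc hD₀
  obtain ⟨lam, hl, hlip⟩ := hS.lip D hD
  obtain ⟨B₁, hB₁⟩ := (hD.image hσ).isBounded.exists_norm_le
  set B := |B₁| with hBdef
  have hB0 : 0 ≤ B := abs_nonneg _
  have hB : ∀ y ∈ D, |σ y| ≤ B := fun y hy => (hB₁ _ (mem_image_of_mem _ hy)).trans (le_abs_self _)
  have huc := hD.uniformContinuousOn_of_continuous hσ.continuousOn
  rw [Metric.uniformContinuousOn_iff_le] at huc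
  obtain ⟨r, hr, hru⟩ := huc (κ/3) (by positivity)
  set A := Real.exp (10 * ∫ ξ in (0:ℝ)..T, lam ξ) with hA
  have hA0 : 0 < A := by positivity
  set Q := 2 * R with hQ
  have hQ0 : 0 ≤ Q := by positivity
  set ε := min 1 (min (r ^ 4 / (4 * B + 1)) (κ / 3 / (2 * A))) with hεd
  have hε : 0 < ε := by
    rw [hεd]; positivity
  have hε1 : ε ≤ 1 := min_le_left _ _
  have hε2 : ε * (4 * B + 1) ≤ r ^ 4 := by
    rw [← le_div_iff₀ (by positivity)]
    exact (min_le_right _ _).trans (min_le_left _ _)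
  have hε3 : ε * (2 * A) ≤ κ / 3 := by
    rw [← le_div_iff₀ (by positivity)]
    exact (min_le_right _ _).trans (min_le_right _ _)
  set C := 18 * A * Q ^ 2 / ε ^ 3 + 1 + 4 * A * Q ^ 3 / ε ^ 3 with hC
  have hC0 : 0 < C := by positivity
  have hcT0 := int_nonneg hS.hc le_rfl hT.out.le le_rfl
  have hlT0 := int_nonneg hl le_rfl hT.out.le le_rfl
  set G := 2 * ((1 + R) * ∫ ξ in (0:ℝ)..T, c ξ) + ∫ ξ in (0:ℝ)..T, lam ξ with hG
  have hG0 : 0 ≤ G := by positivity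
  set δ := κ / 3 / (C * (G + 1)) with hδ
  have hδ0 : 0 < δ := by positivity
  have hCδ : C * δ * G ≤ κ / 3 := by
    have : C * δ * G = κ / 3 * (G / (G + 1)) := by rw [hδ]; field_simp
    rw [this]
    have : G / (G + 1) ≤ 1 := by rw [div_le_one (by positivity)]; linarith
    nlinarith
  obtain ⟨ρ', hρ', hρc⟩ := unif_int hT.out.le hS.hc.1 (δ := δ / (2 * (1 + R))) (by positivity)
  refine ⟨ε, hε, ρ', hρ', fun N g Φ hAp hmesh i hi => ?_⟩
  have hbase : ∀ y₁ ∈ Reach c D₀, ∀ y₂ ∈ Reach c D₀, σ y₁ - σ y₂ ≤ κ/3 + ‖y₁ - y₂‖ ^ 4 / (2 * ε ^ 3) := by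
    intro y₁ h1 y₂ h2
    rcases le_total (‖y₁ - y₂‖) r with h3 | h3
    · have h4 := hru y₁ (hSD h1) y₂ (hSD h2) (by rw [dist_eq_norm]; exact h3)
      rw [Real.dist_eq] at h4
      have : 0 ≤ ‖y₁ - y₂‖ ^ 4 / (2 * ε ^ 3) := by positivity
      linarith [le_abs_self (σ y₁ - σ y₂)]
    · have h4 : 2 * B ≤ ‖y₁ - y₂‖ ^ 4 / (2 * ε ^ 3) := by
        rw [le_div_iff₀ (by positivity)]
        have e1 : r ^ 4 ≤ ‖y₁ - y₂‖ ^ 4 := pow_le_pow_left₀ hr.le h3 4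
        have e2 : ε ^ 3 ≤ ε := pow_le_of_le_one hε.le hε1 (by norm_num)
        have e3 : B * ε ^ 3 ≤ B * ε := by gcongr
        nlinarith
      have := (abs_le.1 (hB y₁ (hSD h1))).2
      have := (abs_le.1 (hB y₂ (hSD h2))).1
      linarith
  have hm : ∀ i, 2 * ((1 + R) * ∫ ξ in (g i)..(g (i+1)), c ξ) ≤ δ := by
    intro i
    have := (le_abs_self _).trans (hρc _ _ (hAp.gI i).1 (hAp.mono (Nat.le_succ i)) (hAp.gI (i+1)).2 (hmesh i))
    rw [le_div_iff₀ (by positivity)] at this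
    linarith
  have one : ∀ x₁ ∈ Reach c D₀, ∀ x₂ ∈ Reach c D₀, ‖stopPath (g i) (x₁ - x₂)‖ ≤ ε → Φ i x₁ - Φ i x₂ ≤ κ := by
    intro x₁ h1 x₂ h2 hx
    have key := compare_core hS hSD hl hlip hR0 hR hε hbase hA hQ hC hAp hm (N - i) i (by omega) x₁ h1 x₂ h2
    refine key.trans ?_
    set M := ‖stopPath (g i) (x₁ - x₂)‖ with hM
    have gi := hAp.gI i
    have a1 : Real.exp (10 * ∫ ξ in (g i)..T, lam ξ) ≤ A := by
      rw [hA]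
      refine Real.exp_le_exp.2 ?_
      have := int_mono hl le_rfl gi.1 gi.2 (le_refl T) le_rfl
      linarith
    have a2 : ups (M ^ 2) (‖evalP (x₁ - x₂) (g i)‖ ^ 2) ≤ ε ^ 4 := by
      refine (ups_upper (sq_nonneg _) (pow_le_pow_left₀ (norm_nonneg _) (norm_eval_le_stop gi.1 le_rfl _) 2)).trans ?_
      rw [← pow_mul]
      exact pow_le_pow_left₀ (norm_nonneg _) hx 4
    have a3 : ε + ups (M ^ 2) (‖evalP (x₁ - x₂) (g i)‖ ^ 2) / ε ^ 3 ≤ 2 * ε := by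
      have : ups (M ^ 2) (‖evalP (x₁ - x₂) (g i)‖ ^ 2) / ε ^ 3 ≤ ε := by
        rw [div_le_iff₀ (by positivity)]
        calc _ ≤ ε ^ 4 := a2
          _ = _ := by ring
      linarith
    have a4 : Real.exp (10 * ∫ ξ in (g i)..T, lam ξ) * (ε + ups (M ^ 2) (‖evalP (x₁ - x₂) (g i)‖ ^ 2) / ε ^ 3) ≤
        A * (2 * ε) := by
      calc _ ≤ Real.exp (10 * ∫ ξ in (g i)..T, lam ξ) * (2 * ε) := by gcongr
        _ ≤ _ := by gcongr
    have a5 : 2 * ((1 + R) * ∫ ξ in (g i)..T, c ξ) + ∫ ξ in (g i)..T, lam ξ ≤ G := by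
      have b1 := int_mono hl le_rfl gi.1 gi.2 (le_refl T) le_rfl
      have b2 := int_mono hS.hc le_rfl gi.1 gi.2 (le_refl T) le_rfl
      rw [hG]; gcongr
    have a6 : C * δ * (2 * ((1 + R) * ∫ ξ in (g i)..T, c ξ) + ∫ ξ in (g i)..T, lam ξ) ≤ C * δ * G := by gcongr
    linarith
  intro x₁ h1 x₂ h2 hx
  refine abs_le.2 ⟨?_, one x₁ h1 x₂ h2 hx⟩
  have := one x₂ h2 x₁ h1 (by
    rw [stopPath_sub, norm_sub_rev, ← stopPath_sub]; exact hx)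
  linarith

/-- (E3) -/
lemma Appr_time {H : ℝ → PathSp n h T → Euc n → ℝ} {c : ℝ → ℝ} (hS : Sys H c) {σ : PathSp n h T → ℝ}
    (hσ : Continuous σ) {D₀ : Set (PathSp n h T)} (hD₀ : IsCompact D₀) {κ : ℝ} (hκ : 0 < κ) :
    ∃ ρ > 0, ∃ ρ' > 0, ∀ N g Φ, Appr H c σ N g Φ → (∀ i, g (i+1) - g i ≤ ρ') → ∀ i j, i ≤ j → j ≤ N →
      g j - g i ≤ ρ → ∀ x ∈ Reach c D₀, |Φ i x - Φ j (stopPath (g i) x)| ≤ κ := by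
  obtain ⟨D, hD, hSD⟩ := Reach_compact hS.hc hD₀
  obtain ⟨R, hR0, hR⟩ := Reach_bdd hS.hc hD₀
  obtain ⟨m, hm, hmb⟩ := hS.bdd D hD
  obtain ⟨ρ₁, hρ₁, ρ', hρ', hE⟩ := Appr_equi hS hσ hD₀ (κ := κ/3) (by positivity)
  obtain ⟨ρ₂, hρ₂, hc2⟩ := unif_int hT.out.le hS.hc.1 (δ := ρ₁ / (1 + R)) (by positivity)
  obtain ⟨ρ₃, hρ₃, hm3⟩ := unif_int hT.out.le hm.1 (δ := κ/3) (by positivity)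
  refine ⟨min ρ₂ ρ₃, by positivity, ρ', hρ', fun N g Φ hAp hmesh i j hij hj hg x hx => ?_⟩
  have gi := hAp.gI i
  have gj := hAp.gI j
  have gij := hAp.mono hij
  have hzS := Reach_stop hS.hc hx gi
  have key : ∀ y ∈ Ad c (g i) x, |FF H (g i) (g j) (Φ j) 0 y - Φ j (stopPath (g i) x)| ≤ 2 * (κ / 3) := by
    intro y hy
    have hyS := Reach_inv hS.hc hx gi hy
    have e1 : ‖stopPath (g j) (y - stopPath (g i) x)‖ ≤ ρ₁ := by
      have : stopPath (g j) (y - stopPath (g i) x) = stopPath (g j) y - stopPath (g i) y := by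
        rw [stopPath_sub, hy.1, stop_stop gj.1 gi.1, min_eq_right gij]
      rw [this]
      refine stop_incr gi.1 gij hρ₁.le fun u h1 h2 => ?_
      refine (Ad_incr hS.hc gi.1 hy (hR y hyS) le_rfl h1 (h2.trans gj.2)).trans ?_
      have := (le_abs_self _).trans (hc2 (g i) u gi.1 h1 (h2.trans gj.2) (by linarith [min_le_left ρ₂ ρ₃]))
      rw [le_div_iff₀ (by positivity)] at this
      linarith
    have e2 := hE N g Φ hAp hmesh j hj y hyS _ hzS e1
    have e3 := II_zero hm hmb gi.1 gij gj.2 (hSD hyS)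
    have e4 := (le_abs_self _).trans (hm3 (g i) (g j) gi.1 gij gj.2 (by linarith [min_le_right ρ₂ ρ₃]))
    unfold FF
    rw [inner_zero_left, sub_zero, add_sub_right_comm]
    exact (abs_add_le _ _).trans (by linarith)
  refine abs_le.2 ⟨?_, ?_⟩
  · obtain ⟨y, hy, h1⟩ := hAp.multiU hS hij hj x 0 (η := κ/3) (by positivity)
    linarith [(abs_le.1 (key y hy)).1]
  · obtain ⟨y, hy, h1⟩ := hAp.multiL hS hij hj x 0 (η := κ/3) (by positivity)
    linarith [(abs_le.1 (key y hy)).2]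

end CompSec

section Limit

variable {n : ℕ} {h T : ℝ} [hT : Fact (0 < T)] [hh : Fact (0 ≤ h)]

/-- limit data -/
structure LimD (H : ℝ → PathSp n h T → Euc n → ℝ) (c : ℝ → ℝ) (σ : PathSp n h T → ℝ) (U : Ultrafilter ℕ)
    (g : ℕ → ℕ → ℝ) (idx : ℕ → ℝ → ℕ) (Φ : ℕ → ℕ → PathSp n h T → ℝ) (φ : ℝ → PathSp n h T → ℝ) : Prop where
  hU : (U : Filter ℕ) ≤ atTop
  A : ∀ k, Appr H c σ (k+1) (g k) (Φ k)
  mesh : ∀ ρ > 0, ∀ᶠ k in (U : Filter ℕ), ∀ i, g k (i+1) - g k i ≤ ρ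
  idx_le : ∀ k, ∀ t ∈ Icc (0:ℝ) T, idx k t ≤ k + 1
  idx_mono : ∀ k t t', t ≤ t' → idx k t ≤ idx k t'
  idx_ge : ∀ k, ∀ t ∈ Icc (0:ℝ) T, t ≤ g k (idx k t)
  idx_lim : ∀ t ∈ Icc (0:ℝ) T, Tendsto (fun k => g k (idx k t)) U (𝓝 t)
  lim : ∀ t ∈ Icc (0:ℝ) T, ∀ x, Tendsto (fun k => Φ k (idx k t) (stopPath t x)) U (𝓝 (φ t x))

variable {H : ℝ → PathSp n h T → Euc n → ℝ} {c : ℝ → ℝ} {σ : PathSp n h T → ℝ} {U : Ultrafilter ℕ}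
    {g : ℕ → ℕ → ℝ} {idx : ℕ → ℝ → ℕ} {Φ : ℕ → ℕ → PathSp n h T → ℝ} {φ : ℝ → PathSp n h T → ℝ}

lemma LimD.neg (hL : LimD H c σ U g idx Φ φ) :
    LimD (negH H) c (fun x => - σ x) U g idx (fun k i x => - Φ k i x) (fun t x => - φ t x) :=
  ⟨hL.hU, fun k => (hL.A k).neg, hL.mesh, hL.idx_le, hL.idx_mono, hL.idx_ge, hL.idx_lim,
    fun t ht x => (hL.lim t ht x).neg⟩

lemma LimD.modulus (hS : Sys H c) (hσ : Continuous σ) (hL : LimD H c σ U g idx Φ φ)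
    {D₀ : Set (PathSp n h T)} (hD₀ : IsCompact D₀) {κ : ℝ} (hκ : 0 < κ) :
    ∃ ρ > 0, ∀ t ∈ Icc (0:ℝ) T, ∀ t' ∈ Icc (0:ℝ) T, t ≤ t' → t' - t < ρ → ∀ x ∈ Reach c D₀, ∀ x' ∈ Reach c D₀,
      ‖stopPath t x - stopPath t' x'‖ ≤ ρ → |φ t x - φ t' x'| ≤ κ := by
  obtain ⟨ρ₁, hρ₁, r₁, hr₁, h1⟩ := Appr_equi hS hσ hD₀ (half_pos hκ)
  obtain ⟨ρ₂, hρ₂, r₂, hr₂, h2⟩ := Appr_time hS hσ hD₀ (half_pos hκ)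
  refine ⟨min ρ₁ ρ₂, lt_min hρ₁ hρ₂, fun t ht t' ht' htt hd x hx x' hx' hn => ?_⟩
  have hlim := ((hL.lim t ht x).sub (hL.lim t' ht' x')).abs
  refine le_of_tendsto hlim ?_
  have e1 : ∀ᶠ k in (U : Filter ℕ), g k (idx k t') - g k (idx k t) < ρ₂ := by
    have := (hL.idx_lim t' ht').sub (hL.idx_lim t ht)
    exact this.eventually_lt_const (hd.trans_le (min_le_right _ _))
  filter_upwards [e1, hL.mesh r₁ hr₁, hL.mesh r₂ hr₂] with k e1 m1 m2
  have a1 := h2 (k+1) (g k) (Φ k) (hL.A k) m2 (idx k t) (idx k t') (hL.idx_mono k _ _ htt) (hL.idx_le k t' ht')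
    e1.le (stopPath t x) (Reach_stop hS.hc hx ht)
  rw [stop_stop ((hL.A k).gI _).1 ht.1, min_eq_right (hL.idx_ge k t ht)] at a1
  have a2 := h1 (k+1) (g k) (Φ k) (hL.A k) m1 (idx k t') (hL.idx_le k t' ht') (stopPath t x)
    (Reach_stop hS.hc hx ht) (stopPath t' x') (Reach_stop hS.hc hx' ht')
    ((norm_stop_le _ _).trans (hn.trans (min_le_left _ _)))
  rw [abs_le] at *
  constructor <;> linarith [a1.1, a1.2, a2.1, a2.2]

lemma LimD.cont (hS : Sys H c) (hσ : Continuous σ) (hL : LimD H c σ U g idx Φ φ) :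
    ContinuousOn (fun p : ℝ × PathSp n h T => φ p.1 p.2) (Icc 0 T ×ˢ (univ : Set (PathSp n h T))) := by
  rintro ⟨t, x⟩ ⟨ht, -⟩
  rw [ContinuousWithinAt, tendsto_iff_seq_tendsto]
  intro u hu
  rw [tendsto_nhdsWithin_iff] at hu
  obtain ⟨hu, hm⟩ := hu
  have hu2 : Tendsto (fun m => (u m).2) atTop (𝓝 x) := (continuous_snd.tendsto _).comp hu
  have hu1 : Tendsto (fun m => (u m).1) atTop (𝓝 t) := (continuous_fst.tendsto _).comp hu
  have hD₀ := hu2.isCompact_insert_range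
  have hst : Tendsto (fun m => ‖stopPath (u m).1 (u m).2 - stopPath t x‖) atTop (𝓝 0) := by
    have h0 : Tendsto (fun m => stopPath (u m).1 (u m).2) atTop (𝓝 (stopPath t x)) :=
      (continuous_stop.tendsto (t, x)).comp hu
    exact tendsto_iff_norm_sub_tendsto_zero.1 h0
  rw [Metric.tendsto_atTop']
  intro ε hε
  obtain ⟨ρ, hρ, hM⟩ := hL.modulus hS hσ hD₀ (half_pos hε)
  have e1 : ∀ᶠ m in atTop, |(u m).1 - t| < ρ := by
    have := (hu1.sub_const t).abs
    simp only [sub_self, abs_zero] at this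
    exact this.eventually_lt_const hρ
  have key : ∀ᶠ m in atTop, dist (φ (u m).1 (u m).2) (φ t x) < ε := by
    filter_upwards [e1, hm, hst.eventually_lt_const hρ] with m e1 hm e2
    have hx1 : (u m).2 ∈ Reach c (insert x (range fun m => (u m).2)) :=
      Reach_self hS.hc (mem_insert_of_mem _ ⟨m, rfl⟩)
    have hx2 : x ∈ Reach c (insert x (range fun m => (u m).2)) := Reach_self hS.hc (mem_insert _ _)
    rw [abs_lt] at e1
    rw [Real.dist_eq]
    rcases le_total (u m).1 t with hle | hle
    · exact (hM _ hm.1 _ ht hle (by linarith) _ hx1 _ hx2 e2.le).trans_lt (by linarith)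
    · rw [abs_sub_comm]
      exact (hM _ ht _ hm.1 hle (by linarith) _ hx2 _ hx1 (by rw [norm_sub_rev]; exact e2.le)).trans_lt (by linarith)
  obtain ⟨M, hM⟩ := eventually_atTop.1 key
  exact ⟨M, fun m hm => hM m hm.le⟩

lemma evalP_conv {ι : Type*} {F : Filter ι} {y : ι → PathSp n h T} {y₀ : PathSp n h T} {b : ι → ℝ} {b₀ : ℝ}
    (hy : Tendsto y F (𝓝 y₀)) (hb : Tendsto b F (𝓝 b₀)) : Tendsto (fun k => evalP (y k) (b k)) F (𝓝 (evalP y₀ b₀)) := by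
  have h1 : Tendsto (fun k => evalP y₀ (b k)) F (𝓝 (evalP y₀ b₀)) := ((continuous_evalP y₀).tendsto _).comp hb
  have h2 : Tendsto (fun k => evalP (y k - y₀) (b k)) F (𝓝 0) := by
    refine squeeze_zero_norm (fun k => norm_evalP_le _ _) ?_
    exact tendsto_iff_norm_sub_tendsto_zero.1 hy
  have h3 := h2.add h1
  simp only [evalP_sub, sub_add_cancel, zero_add] at h3
  exact h3

lemma II_conv {ι : Type*} {F : Filter ι} (hS : Sys H c) {D : Set (PathSp n h T)} (hD : IsCompact D)
    {y : ι → PathSp n h T} {y₀ : PathSp n h T} {a b : ι → ℝ} {a₀ b₀ : ℝ} (s : Euc n)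
    (hyD : ∀ k, y k ∈ D) (hy₀ : y₀ ∈ D) (ha0 : ∀ k, 0 ≤ a k) (hab : ∀ k, a k ≤ b k) (hbT : ∀ k, b k ≤ T)
    (ha₀ : a₀ ∈ Icc (0:ℝ) T) (hb₀ : b₀ ∈ Icc (0:ℝ) T)
    (hy : Tendsto y F (𝓝 y₀)) (ha : Tendsto a F (𝓝 a₀)) (hb : Tendsto b F (𝓝 b₀)) :
    Tendsto (fun k => II H (a k) (b k) (y k) s) F (𝓝 (II H a₀ b₀ y₀ s)) := by
  obtain ⟨lam, hl, hlip⟩ := hS.lip D hD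
  have hT0 : (0:ℝ) ≤ T := hT.out.le
  have h1 : Tendsto (fun k => II H (a k) (b k) (y k) s - II H (a k) (b k) y₀ s) F (𝓝 0) := by
    refine squeeze_zero_norm (a := fun k => (1 + ‖s‖) * ‖y k - y₀‖ * ∫ ξ in (0:ℝ)..T, lam ξ) (fun k => ?_) ?_
    · rw [Real.norm_eq_abs]
      refine (II_lip hS hl hlip (ha0 k) (hab k) (hbT k) (hyD k) hy₀ s).trans ?_
      have q1 := norm_stop_le (b k) (y k - y₀)
      have q2 := int_mono hl le_rfl (ha0 k) (hab k) (hbT k) le_rfl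
      have q3 := int_nonneg hl (ha0 k) (hab k) (hbT k)
      gcongr
    · have := ((tendsto_iff_norm_sub_tendsto_zero.1 hy).const_mul (1 + ‖s‖)).mul_const (∫ ξ in (0:ℝ)..T, lam ξ)
      simpa using this
  have hP : ContinuousOn (fun u => II H 0 u y₀ s) (Icc 0 T) := by
    have := intervalIntegral.continuousOn_primitive_interval (f := fun ξ => H ξ y₀ s) (μ := volume) (a := 0) (b := T)
      (by rw [uIcc_of_le hT0]; exact hS.int y₀ s)
    rwa [uIcc_of_le hT0] at this
  have hPa : Tendsto (fun k => II H 0 (a k) y₀ s) F (𝓝 (II H 0 a₀ y₀ s)) :=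
    (hP a₀ ha₀).tendsto.comp (tendsto_nhdsWithin_iff.2 ⟨ha, .of_forall fun k => ⟨ha0 k, (hab k).trans (hbT k)⟩⟩)
  have hPb : Tendsto (fun k => II H 0 (b k) y₀ s) F (𝓝 (II H 0 b₀ y₀ s)) :=
    (hP b₀ hb₀).tendsto.comp (tendsto_nhdsWithin_iff.2 ⟨hb, .of_forall fun k => ⟨(ha0 k).trans (hab k), hbT k⟩⟩)
  have hsub : ∀ p ∈ Icc (0:ℝ) T, ∀ q ∈ Icc (0:ℝ) T, II H p q y₀ s = II H 0 q y₀ s - II H 0 p y₀ s := by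
    intro p hp q hq
    exact (intervalIntegral.integral_interval_sub_left (ii_of (hS.int y₀ s) le_rfl hq.1 hq.2)
      (ii_of (hS.int y₀ s) le_rfl hp.1 hp.2)).symm
  have h3 := h1.add (hPb.sub hPa)
  rw [zero_add, ← hsub _ ha₀ _ hb₀] at h3
  refine h3.congr fun k => ?_
  rw [← hsub _ ⟨ha0 k, (hab k).trans (hbT k)⟩ _ ⟨(ha0 k).trans (hab k), hbT k⟩]; ring

lemma LimD.limU (hS : Sys H c) (hσ : Continuous σ) (hL : LimD H c σ U g idx Φ φ) {t τ : ℝ} (ht : t ∈ Icc (0:ℝ) T)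
    (hτ : τ ∈ Icc (0:ℝ) T) (htτ : t ≤ τ) (x : PathSp n h T) (s : Euc n) :
    ∃ y ∈ Ad c t x, FF H t τ (φ τ) s y ≤ φ t x := by
  have hex : ∀ k, ∃ y ∈ Ad c t x, FF H (g k (idx k t)) (g k (idx k τ)) (Φ k (idx k τ)) s y ≤
      Φ k (idx k t) (stopPath t x) + 1 / ((k:ℝ) + 1) := by
    intro k
    obtain ⟨y, hy, h1⟩ := (hL.A k).multiU hS (hL.idx_mono k _ _ htτ) (hL.idx_le k τ hτ) (stopPath t x) s
      (η := 1 / ((k:ℝ) + 1)) (by positivity)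
    exact ⟨y, Ad_concat hS.hc ht.1 (hL.idx_ge k t ht) (Ad_self hS.hc ht.1 x) hy, h1⟩
  choose y hy h1 using hex
  obtain ⟨y₀, hy₀, hlim⟩ := (Ad_compact hS.hc ht x).ultrafilter_le_nhds (U.map y)
    (by rw [le_principal_iff]; exact Filter.mem_map.2 (univ_mem' hy))
  have hlim : Tendsto y U (𝓝 y₀) := hlim
  have hga := hL.idx_lim t ht
  have hgb := hL.idx_lim τ hτ
  have hxR : x ∈ Reach c {x} := Reach_self hS.hc rfl
  have hyR : ∀ k, y k ∈ Reach c {x} := fun k => ⟨t, ht, x, rfl, hy k⟩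
  have hy₀R : y₀ ∈ Reach c {x} := ⟨t, ht, x, rfl, hy₀⟩
  have c1 : Tendsto (fun k => Φ k (idx k τ) (y k) - Φ k (idx k τ) (stopPath τ y₀)) U (𝓝 0) := by
    have hn : Tendsto (fun k => ‖y k - y₀‖ + ‖stopPath (g k (idx k τ)) y₀ - stopPath τ y₀‖) U (𝓝 0) := by
      have q1 := tendsto_iff_norm_sub_tendsto_zero.1 hlim
      have q2 := tendsto_iff_norm_sub_tendsto_zero.1 (((continuous_stop_t y₀).tendsto τ).comp hgb)
      simpa using q1.add q2
    rw [Metric.tendsto_nhds]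
    intro ε hε
    obtain ⟨ρ, hρ, r, hr, h2⟩ := Appr_equi hS hσ (isCompact_singleton (x := x)) (half_pos hε)
    filter_upwards [hn.eventually_lt_const hρ, hL.mesh r hr] with k e1 e2
    rw [Real.dist_eq, sub_zero]
    refine (h2 (k+1) (g k) (Φ k) (hL.A k) e2 (idx k τ) (hL.idx_le k τ hτ) _ (hyR k) _
      (Reach_stop hS.hc hy₀R hτ) (le_trans ?_ e1.le)).trans_lt (by linarith)
    have q : stopPath (g k (idx k τ)) (y k - stopPath τ y₀) =
        stopPath (g k (idx k τ)) (y k - y₀) + (stopPath (g k (idx k τ)) y₀ - stopPath τ y₀) := by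
      rw [stopPath_sub, stopPath_sub, stop_stop ((hL.A k).gI _).1 hτ.1, min_eq_right (hL.idx_ge k τ hτ)]; abel
    rw [q]
    exact (norm_add_le _ _).trans (add_le_add_left (norm_stop_le _ _) _)
  have c2 : Tendsto (fun k => Φ k (idx k τ) (y k)) U (𝓝 (φ τ y₀)) := by
    have := c1.add (hL.lim τ hτ y₀)
    simpa using this
  have c3 : Tendsto (fun k => inner ℝ s (evalP (y k) (g k (idx k τ)) - evalP (y k) (g k (idx k t)))) U
      (𝓝 (inner ℝ s (evalP y₀ τ - evalP y₀ t))) :=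
    tendsto_const_nhds.inner ((evalP_conv hlim hgb).sub (evalP_conv hlim hga))
  obtain ⟨D, hD, hsub⟩ := Reach_compact hS.hc (isCompact_singleton (x := x))
  have c4 := II_conv (F := (U : Filter ℕ)) hS hD s (fun k => hsub (hyR k)) (hsub hy₀R) (fun k => ((hL.A k).gI (idx k t)).1)
    (fun k => (hL.A k).mono (hL.idx_mono k _ _ htτ)) (fun k => ((hL.A k).gI (idx k τ)).2) ht hτ hlim hga hgb
  have c5 : Tendsto (fun k : ℕ => Φ k (idx k t) (stopPath t x) + 1 / ((k:ℝ) + 1)) U (𝓝 (φ t x)) := by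
    have := (hL.lim t ht x).add (tendsto_one_div_add_atTop_nhds_zero_nat.mono_left hL.hU)
    simpa using this
  refine ⟨y₀, hy₀, ?_⟩
  exact le_of_tendsto_of_tendsto' ((c2.sub c3).add c4) c5 h1

lemma FF_pair (hS : Sys H c) {t τ : ℝ} (ht : t ∈ Icc (0:ℝ) T) (hτ : τ ∈ Icc (0:ℝ) T) (htτ : t ≤ τ) {x y : PathSp n h T}
    {v : ℝ → Euc n} (hv : (y, v) ∈ YPair t x c) (ψ : PathSp n h T → ℝ) (s : Euc n) :
    FF H t τ ψ s y = ψ y - ∫ ξ in t..τ, (@inner ℝ _ _ s (v ξ) - H ξ y s) := by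
  obtain ⟨⟨-, hi, he⟩, -⟩ := hv
  have hi' : IntervalIntegrable v volume t τ := hi.mono_set (by
    rw [uIcc_of_le htτ, uIcc_of_le ht.2]; exact Icc_subset_Icc le_rfl hτ.2)
  have e := he τ ⟨htτ, hτ.2⟩
  have q : (∫ ξ in t..τ, (@inner ℝ _ _ s (v ξ))) = inner ℝ s (∫ ξ in t..τ, v ξ) :=
    (innerSL ℝ s).intervalIntegral_comp_comm hi'
  have w : IntervalIntegrable (fun ξ => @inner ℝ _ _ s (v ξ)) volume t τ :=
    ⟨(innerSL ℝ s).integrable_comp hi'.1, (innerSL ℝ s).integrable_comp hi'.2⟩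
  rw [intervalIntegral.integral_sub w (ii_of (hS.int y s) ht.1 htτ hτ.2), q]
  unfold FF II
  simp only at e
  rw [e, add_sub_cancel_left]; ring

lemma LimD.propU (hS : Sys H c) (hσ : Continuous σ) (hL : LimD H c σ U g idx Φ φ) : PropU H c φ := by
  intro t ht x s τ hτ
  have ht' : t ∈ Icc (0:ℝ) T := ⟨ht.1, ht.2.le⟩
  have hτ' : τ ∈ Icc (0:ℝ) T := ⟨ht.1.trans hτ.1.le, hτ.2⟩
  obtain ⟨y, hy, h1⟩ := hL.limU hS hσ ht' hτ' hτ.1.le x s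
  obtain ⟨v, hv⟩ := Ad_pair hS.hc ht'.1 ht'.2 hy
  refine ⟨(y, v), hv, ?_⟩
  rwa [FF_pair hS ht' hτ' hτ.1.le hv] at h1

lemma LimD.propL (hS : Sys H c) (hσ : Continuous σ) (hL : LimD H c σ U g idx Φ φ) : PropL H c φ := by
  intro t ht x s τ hτ
  have ht' : t ∈ Icc (0:ℝ) T := ⟨ht.1, ht.2.le⟩
  have hτ' : τ ∈ Icc (0:ℝ) T := ⟨ht.1.trans hτ.1.le, hτ.2⟩
  obtain ⟨y, hy, h1⟩ := hL.neg.limU hS.neg hσ.neg ht' hτ' hτ.1.le x (-s)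
  obtain ⟨v, hv⟩ := Ad_pair hS.hc ht'.1 ht'.2 hy
  refine ⟨(y, v), hv, ?_⟩
  rw [FF_neg, neg_neg, FF_pair hS ht' hτ' hτ.1.le hv] at h1
  exact neg_le_neg_iff.1 h1

/-- uniform grid -/
def gridP (T : ℝ) (k i : ℕ) : ℝ := min ((i:ℝ) * (T / ((k:ℝ) + 1))) T

/-- grid index -/
def idxP (T : ℝ) (k : ℕ) (t : ℝ) : ℕ := ⌈t / (T / ((k:ℝ) + 1))⌉₊

lemma exists_LimD (hS : Sys H c) (hσ : Continuous σ) : ∃ U g idx Φ φ, LimD H c σ U g idx Φ φ ∧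
    (∀ k, idx k T = k + 1) := by
  have hT0 : 0 < T := hT.out
  have hstep : ∀ k : ℕ, 0 < T / ((k:ℝ) + 1) := fun k => by positivity
  have mono : ∀ k, Monotone (gridP T k) := by
    intro k i j hij
    unfold gridP
    have := (hstep k).le
    gcongr
  have gI : ∀ k i, gridP T k i ∈ Icc (0:ℝ) T := fun k i =>
    ⟨le_min (mul_nonneg (Nat.cast_nonneg _) (hstep k).le) hT0.le, min_le_right _ _⟩
  have g0 : ∀ k, gridP T k 0 = 0 := fun k => by simp [gridP, hT0.le]
  have hmul : ∀ k : ℕ, ((k:ℝ) + 1) * (T / ((k:ℝ) + 1)) = T := fun k => by field_simp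
  have gN : ∀ k, gridP T k (k+1) = T := fun k => by
    unfold gridP; push_cast; rw [hmul, min_self]
  have mesh : ∀ k i, gridP T k (i+1) - gridP T k i ≤ T / ((k:ℝ) + 1) := by
    intro k i
    unfold gridP; push_cast
    have := (hstep k).le
    rcases min_cases ((i:ℝ) * (T / ((k:ℝ) + 1))) T with q | q
    · linarith [min_le_left (((i:ℝ) + 1) * (T / ((k:ℝ) + 1))) T]
    · linarith [min_le_right (((i:ℝ) + 1) * (T / ((k:ℝ) + 1))) T]
  have hstep0 : Tendsto (fun k : ℕ => T / ((k:ℝ) + 1)) atTop (𝓝 0) := by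
    have := tendsto_one_div_add_atTop_nhds_zero_nat (𝕜 := ℝ) |>.const_mul T
    simpa [div_eq_mul_inv] using this
  have hidxT : ∀ k, idxP T k T = k + 1 := by
    intro k
    unfold idxP
    have : T / (T / ((k:ℝ) + 1)) = ((k + 1 : ℕ) : ℝ) := by push_cast; field_simp
    rw [this, Nat.ceil_natCast]
  have hmono : ∀ k t t', t ≤ t' → idxP T k t ≤ idxP T k t' := by
    intro k t t' htt
    exact Nat.ceil_mono (div_le_div_of_nonneg_right htt (hstep k).le)
  have hle : ∀ k, ∀ t ∈ Icc (0:ℝ) T, idxP T k t ≤ k + 1 := fun k t ht => by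
    rw [← hidxT k]; exact hmono k _ _ ht.2
  have hge : ∀ k, ∀ t ∈ Icc (0:ℝ) T, t ≤ gridP T k (idxP T k t) := by
    intro k t ht
    refine le_min ?_ ht.2
    rw [← div_le_iff₀ (hstep k)]
    exact Nat.le_ceil _
  have hub : ∀ k, ∀ t ∈ Icc (0:ℝ) T, gridP T k (idxP T k t) ≤ t + T / ((k:ℝ) + 1) := by
    intro k t ht
    refine (min_le_left _ _).trans ?_
    have q := (Nat.ceil_lt_add_one (div_nonneg ht.1 (hstep k).le)).le
    have q2 := mul_le_mul_of_nonneg_right q (hstep k).le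
    rw [add_mul, div_mul_cancel₀ _ (hstep k).ne', one_mul] at q2
    exact q2
  choose Φ hA using fun k => Appr_exists hS hσ (mono k) (gI k) (g0 k) (gN k)
  have hU : ((hyperfilter ℕ : Ultrafilter ℕ) : Filter ℕ) ≤ atTop := Nat.hyperfilter_le_atTop
  have hex : ∀ t x, ∃ z, t ∈ Icc (0:ℝ) T →
      Tendsto (fun k => Φ k (idxP T k t) (stopPath t x)) (hyperfilter ℕ : Ultrafilter ℕ) (𝓝 z) := by
    intro t x
    by_cases ht : t ∈ Icc (0:ℝ) T
    · obtain ⟨B, hB⟩ := Appr_bound hS hσ (isCompact_singleton (x := x))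
      have hb : ∀ k, Φ k (idxP T k t) (stopPath t x) ∈ Icc (-B) B := fun k =>
        abs_le.1 (hB _ _ _ (hA k) _ (hle k t ht) _ (Reach_stop hS.hc (Reach_self hS.hc (mem_singleton x)) ht))
      obtain ⟨z, -, hz⟩ := (isCompact_Icc (a := -B) (b := B)).ultrafilter_le_nhds
        ((hyperfilter ℕ).map fun k => Φ k (idxP T k t) (stopPath t x))
        (by rw [le_principal_iff]; exact Filter.mem_map.2 (univ_mem' hb))
      exact ⟨z, fun _ => hz⟩
    · exact ⟨0, fun h => absurd h ht⟩
  choose φ hφ using hex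
  refine ⟨hyperfilter ℕ, gridP T, idxP T, Φ, φ, ⟨hU, hA, ?_, hle, hmono, hge, ?_, fun t ht x => hφ t x ht⟩, hidxT⟩
  · intro ρ hρ
    filter_upwards [(hstep0.mono_left hU).eventually_lt_const hρ] with k hk i
    exact (mesh k i).trans hk.le
  · intro t ht
    refine tendsto_of_tendsto_of_tendsto_of_le_of_le tendsto_const_nhds (h := fun k : ℕ => t + T / ((k:ℝ) + 1)) ?_
      (fun k => hge k t ht) (fun k => hub k t ht)
    have := (hstep0.mono_left hU).const_add t
    simpa using this

lemma minimax_exists (hS : Sys H c) (hσ : Continuous σ) : ∃ φ, MinimaxSol H c σ φ := by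
  have hT0 : 0 < T := hT.out
  obtain ⟨U, g, idx, Φ, φ, hL, hi⟩ := exists_LimD hS hσ
  have hTm : T ∈ Icc (0:ℝ) T := ⟨hT0.le, le_rfl⟩
  have hna : NonAnticipative φ := by
    intro t ht x
    have h1 := hL.lim t ht x
    have h2 := hL.lim t ht (stopPath t x)
    rw [stop_stop ht.1 ht.1, min_self] at h2
    exact tendsto_nhds_unique h1 h2
  have hTσ : ∀ x, φ T x = σ x := by
    intro x
    have h1 := hL.lim T hTm x
    simp only [hi, (hL.A _).last, stop_T] at h1
    exact tendsto_nhds_unique h1 tendsto_const_nhds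
  have hc := hL.cont hS hσ
  exact ⟨φ, ⟨hna, hc.lowerSemicontinuousOn, fun x => (hTσ x).ge, hL.propU hS hσ⟩,
    ⟨hna, hc.upperSemicontinuousOn, fun x => (hTσ x).le, hL.propL hS hσ⟩⟩

end Limit

/-- existence: under Assumption 1 there exists at least one
minimax solution of the Cauchy problem. -/
theorem stmt17 {n : ℕ} {h T : ℝ} (hT : 0 < T) (hh : 0 ≤ h)
    (H : ℝ → PathSp n h T → Euc n → ℝ) (cH : ℝ → ℝ) (hH : CondA H cH)
    (σ : PathSp n h T → ℝ) (hσ : Continuous σ) :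
    ∃ φ : ℝ → PathSp n h T → ℝ, MinimaxSol H cH σ φ := by
  haveI := Fact.mk hT
  haveI := Fact.mk hh
  exact minimax_exists (Sys.of_cond hH) hσ

end
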